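/- arXiv:2512.12878 — 2 statements merged into one kernel-verified Lean document; each statement's English description precedes it below -/
import Mathlib

section
/- Let N = 1 (hence n = p), let v₀ ∈ L²(Ω;ℝⁿ) be continuous on Ω, and let v be a weak solution of ∂_t v + ∇𝔘(v⊗v) = 0, v(0)=v₀ (the gradient of the viscosity solution of the quadratic Hamilton–Jacobi equation) that is continuous on [0,T]×Ω. Then there exists a sequence (v̄_m) of continuous base states such that: (i) v̄_m → 0 strongly in L¹((0,T)×Ω;ℝⁿ); (ii) for every m, ℐ(v₀,v̄_m,T) = 𝒥(v₀,v̄_m,T); (iii) for every m, the dual problem defining 𝒥(v₀,v̄_m,T) has a smooth maximizer (E_m,B_m) with I+2B_m positive definite everywhere in (0,T)×Ω; (iv) v = (I+2B_m)⁻¹(v̄_m − E_m) everywhere in (0,T)×Ω. -/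
open MeasureTheory Matrix

namespace NashDual

/-! Setup: `Ω = 𝕋^{N×p}` is modelled by `ℤ^{N×p}`-periodic functions on `ℝ^{N×p}`,
with spatial integrals taken over the unit cube (which has unit volume). The unknown has
`n = pN²` components, indexed by triples `(i,j,l)`. -/

/-- Spatial coordinate indices of the torus `𝕋^{N×p}`. -/
abbrev SIdx (N p : ℕ) := Fin N × Fin p

/-- Component indices of the unknown (`n = pN²` of them). -/
abbrev VIdx (N p : ℕ) := Fin N × Fin N × Fin p

/-- A spatial point. -/
abbrev Pt (N p : ℕ) := SIdx N p → ℝ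

/-- A value in `ℝⁿ`. -/
abbrev Vec (N p : ℕ) := VIdx N p → ℝ

/-- An `n×n` real matrix (the symmetric ones are singled out by `Matrix.IsSymm`). -/
abbrev SymM (N p : ℕ) := Matrix (VIdx N p) (VIdx N p) ℝ

/-- The fundamental cell of the torus (unit volume). -/
def cube (N p : ℕ) : Set (Pt N p) := Set.univ.pi fun _ => Set.Ico (0 : ℝ) 1

/-- The linear map `𝔘 : Sym(n,ℝ) → ℝ^N`. -/
noncomputable def mfU (N p : ℕ) (A : SymM N p) (i : Fin N) : ℝ :=
  (1 / 2) * ∑ l : Fin p, (A (i, i, l) (i, i, l)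
    + ∑ j ∈ Finset.univ.filter (fun j => j ≠ i), (A (j, j, l) (i, j, l) + A (i, j, l) (j, j, l)))

/-- The differential operator `L w = −∇(𝔘 w)`, `(Lw)_{(i,j,l)} = −∂_{x_{(j,l)}} (𝔘w)_i`. -/
noncomputable def Lop (N p : ℕ) (w : Pt N p → SymM N p) (x : Pt N p) : Vec N p :=
  fun a => - fderiv ℝ (fun y => mfU N p (w y) a.1) x (Pi.single a.2 1)

/-- The `L²(Ω)` pairing `(f,g)` of two `ℝⁿ`-valued fields on `Ω` (at a fixed time). -/
noncomputable def pV (N p : ℕ) (f g : Pt N p → Vec N p) : ℝ :=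
  ∫ x in cube N p, ∑ a, f x a * g x a

/-- The `L²(Ω)` (Frobenius) pairing `(A,B)` of two matrix-valued fields on `Ω`. -/
noncomputable def pM (N p : ℕ) (A B : Pt N p → SymM N p) : ℝ :=
  ∫ x in cube N p, ∑ a, ∑ b, A x a b * B x a b

/-- The space-time domain `(0,T) × Ω`. -/
def domST (N p : ℕ) (T : ℝ) : Set (ℝ × Pt N p) := (Set.Ioo 0 T) ×ˢ cube N p

/-- The space-time measure on `(0,T) × Ω`. -/
noncomputable def μST (N p : ℕ) (T : ℝ) : Measure (ℝ × Pt N p) :=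
  volume.restrict (domST N p T)

/-- `v₀ ∈ L²(Ω;ℝⁿ) = X^n`. -/
def MemL2Om (N p : ℕ) (f : Pt N p → Vec N p) : Prop :=
  (∀ a, Measurable fun x => f x a) ∧
  IntegrableOn (fun x => ∑ a, (f x a) ^ 2) (cube N p)

/-- `v ∈ L²((0,T)×Ω;ℝⁿ)`. -/
def MemL2V (N p : ℕ) (T : ℝ) (f : ℝ → Pt N p → Vec N p) : Prop :=
  (∀ a, Measurable fun q : ℝ × Pt N p => f q.1 q.2 a) ∧
  IntegrableOn (fun q : ℝ × Pt N p => ∑ a, (f q.1 q.2 a) ^ 2) (domST N p T)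

/-- `B ∈ L^∞((0,T)×Ω; Sym(n,ℝ))`. -/
def MemLinfS (N p : ℕ) (T : ℝ) (B : ℝ → Pt N p → SymM N p) : Prop :=
  (∀ a b, Measurable fun q : ℝ × Pt N p => B q.1 q.2 a b) ∧
  (∀ t x, (B t x).IsSymm) ∧
  ∃ C : ℝ, ∀ᵐ q ∂(μST N p T), ∀ a b, |B q.1 q.2 a b| ≤ C

/-- `M ∈ L¹((0,T)×Ω; Sym(n,ℝ))`. -/
def MemL1S (N p : ℕ) (T : ℝ) (M : ℝ → Pt N p → SymM N p) : Prop :=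
  (∀ a b, Measurable fun q : ℝ × Pt N p => M q.1 q.2 a b) ∧
  (∀ t x, (M t x).IsSymm) ∧
  IntegrableOn (fun q : ℝ × Pt N p => ∑ a, ∑ b, |M q.1 q.2 a b|) (domST N p T)

/-- A smooth test field `Ψ : [0,T] → C^∞(Ω;Sym(n,ℝ))` with `Ψ(0) = 0`: jointly smooth,
spatially `ℤ`-periodic, symmetric-matrix-valued, vanishing at `t = 0`. -/
def TestField (N p : ℕ) (Ψ : ℝ → Pt N p → SymM N p) : Prop :=
  (∀ a b, ContDiff ℝ (⊤ : ℕ∞) fun q : ℝ × Pt N p => Ψ q.1 q.2 a b) ∧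
  (∀ t x i, Ψ t (x + Pi.single i 1) = Ψ t x) ∧
  (∀ t x, (Ψ t x).IsSymm) ∧
  (∀ x, Ψ 0 x = 0)

/-- Time derivative `∂_t Ψ` of a test field. -/
noncomputable def dtPsi (N p : ℕ) (Ψ : ℝ → Pt N p → SymM N p) (t : ℝ) (x : Pt N p) :
    SymM N p :=
  Matrix.of fun a b => deriv (fun s => Ψ s x a b) t

/-- The linear constraint `∫₀ᵀ [(B,∂_tΨ) + (E,LΨ)] dt = 0` for all test fields `Ψ`. -/
def ConstraintEB (N p : ℕ) (T : ℝ) (E : ℝ → Pt N p → Vec N p)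
    (B : ℝ → Pt N p → SymM N p) : Prop :=
  ∀ Ψ, TestField N p Ψ →
    ∫ t in Set.Ioo 0 T, (pM N p (B t) (dtPsi N p Ψ t) + pV N p (E t) (Lop N p (Ψ t))) = 0

/-- The admissible class: `(E,B) ∈ L² × L^∞(Sym)` satisfying the linear constraint. -/
def Admissible (N p : ℕ) (T : ℝ) (E : ℝ → Pt N p → Vec N p)
    (B : ℝ → Pt N p → SymM N p) : Prop :=
  MemL2V N p T E ∧ MemLinfS N p T B ∧ ConstraintEB N p T E B

/-- The tensor square `v ⊗ v`. -/
def tensorSq (N p : ℕ) (w : Vec N p) : SymM N p := vecMulVec w w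

/-- Weak solution of `∂_t v + ∇𝔘(v⊗v) = 0`, `v(0) = v₀` (Burgers-like formulation):
`v ∈ L²` with `∫₀ᵀ [(v−v₀,E) + (v⊗v,B)] dt = 0` for all admissible pairs `(E,B)`. -/
def WeakSolution (N p : ℕ) (T : ℝ) (v₀ : Pt N p → Vec N p)
    (v : ℝ → Pt N p → Vec N p) : Prop :=
  MemL2V N p T v ∧
  ∀ E B, Admissible N p T E B →
    ∫ t in Set.Ioo 0 T,
      (pV N p (fun x => v t x - v₀ x) (E t)
        + pM N p (fun x => tensorSq N p (v t x)) (B t)) = 0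

/-- The saddle-point objective of the primal problem. -/
noncomputable def primalObj (N p : ℕ) (T : ℝ) (v₀ : Pt N p → Vec N p)
    (vb v E : ℝ → Pt N p → Vec N p) (B : ℝ → Pt N p → SymM N p) : ℝ :=
  ∫ t in Set.Ioo 0 T,
    ((1 / 2) * pV N p (fun x => v t x - vb t x) (fun x => v t x - vb t x)
      + pV N p (fun x => v t x - v₀ x) (E t)
      + pM N p (fun x => tensorSq N p (v t x)) (B t))

/-- `ℐ(v₀,v̄,T)`: the inf-sup value of the primal problem. -/
noncomputable def Ifun (N p : ℕ) (T : ℝ) (v₀ : Pt N p → Vec N p)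
    (vb : ℝ → Pt N p → Vec N p) : EReal :=
  ⨅ v : {v : ℝ → Pt N p → Vec N p // MemL2V N p T v},
    ⨆ EB : {EB : (ℝ → Pt N p → Vec N p) × (ℝ → Pt N p → SymM N p) //
        Admissible N p T EB.1 EB.2},
      ((primalObj N p T v₀ vb v.1 EB.1.1 EB.1.2 : ℝ) : EReal)

/-- The functional `𝒦(Q,B)`: infimum over `(z,M) ∈ L² × L¹(Sym)` with `M − z⊗z ⪰ 0` a.e.
of `∫₀ᵀ [(z,Q) + ½(M, I+2B)] dt`. -/
noncomputable def Kfun (N p : ℕ) (T : ℝ) (Q : ℝ → Pt N p → Vec N p)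
    (B : ℝ → Pt N p → SymM N p) : EReal :=
  ⨅ zM : {zM : (ℝ → Pt N p → Vec N p) × (ℝ → Pt N p → SymM N p) //
      MemL2V N p T zM.1 ∧ MemL1S N p T zM.2 ∧
      ∀ᵐ q ∂(μST N p T), (zM.2 q.1 q.2 - tensorSq N p (zM.1 q.1 q.2)).PosSemidef},
    ((∫ t in Set.Ioo 0 T,
        (pV N p (zM.1.1 t) (Q t)
          + (1 / 2) * pM N p (zM.1.2 t) (fun x => 1 + 2 • B t x)) : ℝ) : EReal)

/-- The objective of the dual problem: `∫₀ᵀ [−(v₀,E) + ½(v̄,v̄)] dt + 𝒦(E−v̄,B)`. -/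
noncomputable def dualObj (N p : ℕ) (T : ℝ) (v₀ : Pt N p → Vec N p)
    (vb E : ℝ → Pt N p → Vec N p) (B : ℝ → Pt N p → SymM N p) : EReal :=
  ((∫ t in Set.Ioo 0 T,
      (- pV N p (fun x => v₀ x) (E t) + (1 / 2) * pV N p (vb t) (vb t)) : ℝ) : EReal)
    + Kfun N p T (fun t x => E t x - vb t x) B

/-- Dual admissibility: admissible and `I + 2B ⪰ 0` a.e. in `(0,T)×Ω`. -/
def DualAdmissible (N p : ℕ) (T : ℝ) (E : ℝ → Pt N p → Vec N p)
    (B : ℝ → Pt N p → SymM N p) : Prop :=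
  Admissible N p T E B ∧
  ∀ᵐ q ∂(μST N p T), ((1 : SymM N p) + 2 • B q.1 q.2).PosSemidef

/-- `𝒥(v₀,v̄,T)`: the value of the dual problem. -/
noncomputable def Jfun (N p : ℕ) (T : ℝ) (v₀ : Pt N p → Vec N p)
    (vb : ℝ → Pt N p → Vec N p) : EReal :=
  ⨆ EB : {EB : (ℝ → Pt N p → Vec N p) × (ℝ → Pt N p → SymM N p) //
      DualAdmissible N p T EB.1 EB.2},
    dualObj N p T v₀ vb EB.1.1 EB.1.2

end NashDual

namespace NashDual

/-- Periodicity in each coordinate gives periodicity under integer translations. -/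
theorem periodic_int {ι α : Type*} [Fintype ι] [DecidableEq ι] {f : (ι → ℝ) → α}
    (hf : ∀ x i, f (x + Pi.single i 1) = f x) (n : ι → ℤ) (x : ι → ℝ) :
    f (x + fun i => (n i : ℝ)) = f x := by
  have h1 : ∀ i, Function.Periodic f (Pi.single i (n i : ℝ)) := fun i => by
    have h := Function.Periodic.zsmul (f := f) (c := Pi.single i 1) (fun x => hf x i) (n i)
    rwa [← Pi.single_smul, zsmul_one] at h
  have h2 : ∀ s : Finset ι, Function.Periodic f (∑ i ∈ s, Pi.single i (n i : ℝ)) := by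
    intro s
    induction s using Finset.induction_on with
    | empty => intro x; simp
    | insert a s ha ih => rw [Finset.sum_insert ha]; exact (h1 a).add_period ih
  have h3 := h2 Finset.univ x
  rwa [Finset.univ_sum_single (fun i => (n i : ℝ))] at h3

/-- A continuous field, periodic in space, is uniformly continuous in space and bounded, uniformly
over a compact time interval. -/
theorem periodic_unif {ι : Type*} [Fintype ι] [DecidableEq ι] (T : ℝ)
    {V : ℝ → (ι → ℝ) → ι → ℝ} (hV : Continuous fun q : ℝ × (ι → ℝ) => V q.1 q.2)
    (hper : ∀ t x i, V t (x + Pi.single i 1) = V t x) :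
    (∃ C, 0 ≤ C ∧ ∀ t ∈ Set.Icc 0 T, ∀ x, ‖V t x‖ ≤ C) ∧
    ∀ ε > 0, ∃ δ > 0, ∀ t ∈ Set.Icc 0 T, ∀ x y, ‖x - y‖ ≤ δ → ‖V t x - V t y‖ ≤ ε := by
  set K : Set (ℝ × (ι → ℝ)) := Set.Icc 0 T ×ˢ Metric.closedBall 0 2
  have hK : IsCompact K := isCompact_Icc.prod (isCompact_closedBall _ _)
  have red : ∀ x : ι → ℝ, ∃ n : ι → ℤ, ‖x + fun i => (n i : ℝ)‖ ≤ 1 := fun x =>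
    ⟨fun i => -⌊x i⌋, by
      refine (pi_norm_le_iff_of_nonneg zero_le_one).2 fun i => ?_
      have := Int.fract_nonneg (x i)
      have := (Int.fract_lt_one (x i)).le
      simp only [Pi.add_apply, Int.cast_neg, Real.norm_eq_abs]
      rw [← sub_eq_add_neg, Int.self_sub_floor, abs_of_nonneg] <;> assumption⟩
  constructor
  · obtain ⟨C, hC⟩ := hK.exists_bound_of_continuousOn hV.continuousOn
    refine ⟨max C 0, le_max_right _ _, fun t ht x => ?_⟩
    obtain ⟨n, hn⟩ := red x
    rw [← periodic_int (hper t) n x]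
    refine (hC (t, _) ⟨ht, ?_⟩).trans (le_max_left _ _)
    simp only [Metric.mem_closedBall, dist_zero_right]
    linarith
  · intro ε hε
    have hu := hK.uniformContinuousOn_of_continuous hV.continuousOn
    obtain ⟨δ, hδ, h⟩ := Metric.uniformContinuousOn_iff_le.1 hu ε hε
    refine ⟨min δ 1, by positivity, fun t ht x y hxy => ?_⟩
    obtain ⟨n, hn⟩ := red x
    have hd : ‖(x + fun i => (n i : ℝ)) - (y + fun i => (n i : ℝ))‖ ≤ min δ 1 := by simpa using hxy
    rw [← periodic_int (hper t) n x, ← periodic_int (hper t) n y, ← dist_eq_norm]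
    refine h (t, _) ⟨ht, ?_⟩ (t, _) ⟨ht, ?_⟩ ?_
    · simp only [Metric.mem_closedBall, dist_zero_right]; linarith
    · simp only [Metric.mem_closedBall, dist_zero_right]
      have h1 := norm_sub_norm_le (y + fun i => (n i : ℝ)) (x + fun i => (n i : ℝ))
      rw [norm_sub_rev] at h1
      linarith [min_le_right δ 1]
    · rw [Prod.dist_eq]
      simp only [dist_self, dist_eq_norm]
      exact max_le hδ.le (hd.trans (min_le_left _ _))

/-- Tonelli's delayed scheme: a continuously differentiable approximate trajectory. -/
theorem exists_approx_trajectory {ι : Type*} [Fintype ι] [DecidableEq ι] {T : ℝ} (hT : 0 < T)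
    {V : ℝ → (ι → ℝ) → ι → ℝ} (hV : Continuous fun q : ℝ × (ι → ℝ) => V q.1 q.2)
    (hper : ∀ t x i, V t (x + Pi.single i 1) = V t x) (y : ι → ℝ) {ε : ℝ} (hε : 0 < ε) :
    ∃ X X' : ℝ → ι → ℝ, Continuous X' ∧ (∀ t, X t = y + ∫ s in T..t, X' s) ∧
      ∀ t ∈ Set.Icc 0 T, ‖X' t - V t (X t)‖ ≤ ε := by
  obtain ⟨⟨C, hC0, hC⟩, hu⟩ := periodic_unif T hV hper
  obtain ⟨δ, hδ, hδu⟩ := hu ε hε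
  obtain ⟨h, hh, hCh⟩ : ∃ h > 0, C * h ≤ δ :=
    ⟨δ / (C + 1), by positivity, by rw [mul_div_assoc', div_le_iff₀ (by positivity)]; nlinarith⟩
  let Φ : (ℝ → ι → ℝ) → ℝ → ι → ℝ := fun u t => y + ∫ s in T..t, V s (u (min (s + h) T))
  let u : ℕ → ℝ → ι → ℝ := fun k => Φ^[k] fun _ => y
  have hus : ∀ k, u (k + 1) = Φ (u k) := fun k => Function.iterate_succ_apply' _ _ _
  have hΦc : ∀ w, Continuous w → Continuous fun s => V s (w (min (s + h) T)) := fun w hw =>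
    hV.comp (continuous_id.prodMk (hw.comp (by fun_prop)))
  have huc : ∀ k, Continuous (u k) := by
    intro k
    induction k with
    | zero => exact continuous_const
    | succ k ih =>
      rw [hus]
      exact continuous_const.add
        (intervalIntegral.continuous_primitive (fun a b => (hΦc _ ih).intervalIntegrable a b) T)
  have hstab : ∀ k : ℕ, ∀ t, T - k * h ≤ t → t ≤ T → u (k + 1) t = u k t := by
    intro k
    induction k with
    | zero =>
      intro t h1 h2
      have : t = T := by simp at h1; linarith
      subst this
      rw [hus]; simp [Φ, u]
    | succ k ih =>
      intro t h1 h2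
      conv_rhs => rw [hus k]
      rw [hus (k + 1)]
      simp only [Φ]
      congr 1
      refine intervalIntegral.integral_congr fun s hs => ?_
      rw [Set.uIcc_of_ge h2] at hs
      rw [ih _ _ (min_le_right _ _)]
      push_cast at h1
      refine le_min (by linarith [hs.1]) ?_
      have : 0 ≤ (k : ℝ) * h := by positivity
      linarith
  obtain ⟨k, hk⟩ := exists_nat_ge (T / h)
  rw [div_le_iff₀ hh] at hk
  refine ⟨u (k + 1), fun s => V s (u k (min (s + h) T)), hΦc _ (huc k), fun t => ?_, fun t ht => ?_⟩
  · rw [hus]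
  · simp only
    have hm : min (t + h) T ∈ Set.Icc t T := ⟨le_min (by linarith) ht.2, min_le_right _ _⟩
    rw [← hstab k (min (t + h) T) (by linarith [hm.1, ht.1]) hm.2]
    refine hδu t ht _ _ ?_
    have hVint : ∀ a b, IntervalIntegrable (fun s => V s (u k (min (s + h) T))) volume a b :=
      fun a b => (hΦc _ (huc k)).intervalIntegrable a b
    have : u (k + 1) (min (t + h) T) - u (k + 1) t
        = ∫ s in t..(min (t + h) T), V s (u k (min (s + h) T)) := by
      rw [hus]
      simp only [Φ]
      rw [add_sub_add_left_eq_sub, intervalIntegral.integral_interval_sub_left (hVint _ _) (hVint _ _)]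
    rw [this]
    refine (intervalIntegral.norm_integral_le_of_norm_le_const (C := C) fun s hs => ?_).trans ?_
    · rw [Set.uIoc_of_le hm.1] at hs
      exact hC s ⟨by linarith [hs.1, ht.1], by linarith [hs.2, hm.2]⟩ _
    · rw [abs_of_nonneg (by linarith [hm.1])]
      refine le_trans ?_ hCh
      gcongr
      linarith [min_le_left (t + h) T]

/-- A smooth approximate trajectory with prescribed terminal point. -/
theorem exists_smooth_trajectory {ι : Type*} [Fintype ι] [DecidableEq ι] {T : ℝ} (hT : 0 < T)
    {V : ℝ → (ι → ℝ) → ι → ℝ} (hV : Continuous fun q : ℝ × (ι → ℝ) => V q.1 q.2)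
    (hper : ∀ t x i, V t (x + Pi.single i 1) = V t x) (y : ι → ℝ) {ε : ℝ} (hε : 0 < ε) :
    ∃ X X' : ℝ → ι → ℝ, ContDiff ℝ (⊤ : ℕ∞) X ∧ ContDiff ℝ (⊤ : ℕ∞) X' ∧
      (∀ t, HasDerivAt X (X' t) t) ∧ X T = y ∧
      ∀ t ∈ Set.Icc 0 T, ‖X' t - V t (X t)‖ ≤ ε := by
  obtain ⟨-, hu⟩ := periodic_unif T hV hper
  obtain ⟨δ, hδ, hδu⟩ := hu (ε / 3) (by positivity)
  obtain ⟨Y, Y', hY'c, hY, hYV⟩ := exists_approx_trajectory hT hV hper y (ε := ε / 3) (by positivity)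
  set η := min (ε / 3) (δ / T)
  have hη : 0 < η := by positivity
  have hP : ∀ i, ∃ P : Polynomial ℝ, ∀ t ∈ Set.Icc 0 T, |P.eval t - Y' t i| < η := fun i =>
    exists_polynomial_near_of_continuousOn 0 T (fun t => Y' t i)
      ((continuous_apply i).comp hY'c).continuousOn η hη
  choose P hP using hP
  set X' : ℝ → ι → ℝ := fun t i => (P i).eval t
  have hX's : ContDiff ℝ (⊤ : ℕ∞) X' := contDiff_pi.2 fun i => by
    simpa using (P i).contDiff_aeval (⊤ : ℕ∞) (𝕜 := ℝ)
  have hX'c : Continuous X' := hX's.continuous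
  set X : ℝ → ι → ℝ := fun t => y + ∫ s in T..t, X' s
  have hd : ∀ t, HasDerivAt X (X' t) t := fun t =>
    (intervalIntegral.integral_hasDerivAt_right (hX'c.intervalIntegrable _ _)
      hX'c.stronglyMeasurable.stronglyMeasurableAtFilter hX'c.continuousAt).const_add y
  have hnear : ∀ t ∈ Set.Icc 0 T, ‖X' t - Y' t‖ ≤ η := fun t ht =>
    (pi_norm_le_iff_of_nonneg hη.le).2 fun i => (hP i t ht).le
  refine ⟨X, X', ?_, hX's, hd, by simp [X], fun t ht => ?_⟩
  · refine contDiff_infty_iff_deriv.2 ⟨fun t => (hd t).differentiableAt, ?_⟩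
    rwa [show deriv X = X' from funext fun t => (hd t).deriv]
  · have hXY : ‖Y t - X t‖ ≤ δ := by
      rw [hY]
      simp only [X]
      rw [add_sub_add_left_eq_sub, ← intervalIntegral.integral_sub (hY'c.intervalIntegrable _ _)
        (hX'c.intervalIntegrable _ _)]
      refine (intervalIntegral.norm_integral_le_of_norm_le_const (C := η) fun s hs => ?_).trans ?_
      · rw [Set.uIoc_of_ge ht.2] at hs
        rw [norm_sub_rev]
        exact hnear s ⟨by linarith [hs.1, ht.1], hs.2⟩
      · rw [abs_of_nonpos (by linarith [ht.2])]
        calc η * -(t - T) ≤ δ / T * T :=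
              mul_le_mul (min_le_right _ _) (by linarith [ht.1]) (by linarith [ht.2])
                (by positivity)
          _ = δ := by field_simp
    calc ‖X' t - V t (X t)‖
        = ‖(X' t - Y' t) + (Y' t - V t (Y t)) + (V t (Y t) - V t (X t))‖ := by congr 1; abel
      _ ≤ ε / 3 + ε / 3 + ε / 3 := (norm_add₃_le).trans
          (add_le_add (add_le_add ((hnear t ht).trans (min_le_left _ _)) (hYV t ht))
            (hδu t ht _ _ hXY))
      _ = ε := by ring
/-- A smooth `1`-periodic partition of unity on the line subordinate to a grid of mesh `1 / m`. -/
theorem exists_periodic_partition (m : ℕ) (hm : 2 ≤ m) :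
    ∃ θ : Fin m → ℝ → ℝ, (∀ j, ContDiff ℝ (⊤ : ℕ∞) (θ j)) ∧ (∀ j s, 0 ≤ θ j s) ∧
      (∀ j s, θ j (s + 1) = θ j s) ∧ (∀ s, ∑ j, θ j s = 1) ∧
      ∀ j s, θ j s ≠ 0 → ∃ n : ℤ, |s - (j : ℝ) / m - n| ≤ 1 / m := by
  have hm0 : (0 : ℝ) < m := by positivity
  have hm2 : (2 : ℝ) ≤ m := by exact_mod_cast hm
  have hπ : 2 * Real.pi * (1 / m) ≤ Real.pi := by
    rw [mul_one_div, div_le_iff₀ hm0]; nlinarith [Real.pi_pos]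
  let ψ : ℝ → ℝ := fun s =>
    Real.smoothTransition (Real.cos (2 * Real.pi * s) - Real.cos (2 * Real.pi * (1 / m)))
  have hψs : ContDiff ℝ (⊤ : ℕ∞) ψ :=
    Real.smoothTransition.contDiff.comp (((Real.contDiff_cos).comp (by fun_prop)).sub contDiff_const)
  have hψ0 : ∀ s, 0 ≤ ψ s := fun s => Real.smoothTransition.nonneg _
  have hψi : ∀ (s : ℝ) (n : ℤ), ψ (s - n) = ψ s := fun s n => by
    simp only [ψ]
    rw [show 2 * Real.pi * (s - n) = 2 * Real.pi * s - n * (2 * Real.pi) by ring,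
      Real.cos_sub_int_mul_two_pi]
  have hψp : ∀ s, ψ (s + 1) = ψ s := fun s => by simpa using hψi s (-1)
  have hψpos : ∀ s : ℝ, |s| < 1 / m → 0 < ψ s := fun s hs => by
    refine Real.smoothTransition.pos_of_pos (sub_pos.2 ?_)
    rw [← Real.cos_abs (2 * Real.pi * s)]
    refine Real.cos_lt_cos_of_nonneg_of_le_pi (abs_nonneg _) hπ ?_
    rw [abs_mul, abs_of_pos Real.two_pi_pos]
    exact mul_lt_mul_of_pos_left hs Real.two_pi_pos
  have hψsupp : ∀ s : ℝ, ψ s ≠ 0 → ∃ n : ℤ, |s - n| ≤ 1 / m := fun s hs => by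
    refine ⟨round s, ?_⟩
    by_contra! hlt
    refine hs ?_
    rw [← hψi s (round s)]
    refine Real.smoothTransition.zero_of_nonpos (sub_nonpos.2 ?_)
    rw [← Real.cos_abs (2 * Real.pi * (s - round s))]
    have h2 := abs_sub_round s
    rw [abs_mul, abs_of_pos Real.two_pi_pos]
    refine Real.cos_le_cos_of_nonneg_of_le_pi (by positivity) (by nlinarith [Real.pi_pos]) ?_
    exact (mul_le_mul_of_nonneg_left hlt.le Real.two_pi_pos.le)
  let S : ℝ → ℝ := fun s => ∑ j : Fin m, ψ (s - (j : ℝ) / m)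
  have hSpos : ∀ s, 0 < S s := fun s => by
    have hf0 := Int.fract_nonneg s
    have hf1 := Int.fract_lt_one s
    have hlt : ⌊Int.fract s * m⌋₊ < m := by
      rw [Nat.floor_lt (by positivity)]; nlinarith
    refine Finset.sum_pos' (fun j _ => hψ0 _) ⟨⟨_, hlt⟩, Finset.mem_univ _, ?_⟩
    rw [← hψi _ ⌊s⌋]
    apply hψpos
    have h1 := Nat.floor_le (show 0 ≤ Int.fract s * m by positivity)
    have h2 := Nat.lt_floor_add_one (Int.fract s * m)
    have e : s - (⌊Int.fract s * m⌋₊ : ℝ) / m - ⌊s⌋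
        = (Int.fract s * m - ⌊Int.fract s * m⌋₊) / m := by
      rw [Int.fract]; field_simp; ring
    simp only
    rw [e, abs_of_nonneg (div_nonneg (by linarith) hm0.le)]
    exact div_lt_div_of_pos_right (by linarith) hm0
  have hSs : ContDiff ℝ (⊤ : ℕ∞) S :=
    ContDiff.sum fun j _ => hψs.comp (contDiff_id.sub contDiff_const)
  refine ⟨fun j s => ψ (s - (j : ℝ) / m) / S s, fun j => ?_, fun j s => ?_, fun j s => ?_,
    fun s => ?_, fun j s h => ?_⟩
  · exact (hψs.comp (contDiff_id.sub contDiff_const)).div hSs fun s => (hSpos s).ne'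
  · exact div_nonneg (hψ0 _) (hSpos s).le
  · have e : ∀ k : Fin m, ψ (s + 1 - (k : ℝ) / m) = ψ (s - (k : ℝ) / m) := fun k => by
      rw [← hψp (s - (k : ℝ) / m)]; congr 1; ring
    simp only [S, e]
  · simp only
    rw [← Finset.sum_div]
    exact div_self (hSpos s).ne'
  · exact hψsupp _ fun h0 => h (by simp [h0])

/-- A smooth partition of unity of the torus by bumps of small diameter. -/
theorem exists_torus_partition (ι : Type*) [Fintype ι] [DecidableEq ι] {δ : ℝ} (hδ : 0 < δ) :
    ∃ (κ : Type) (_ : Fintype κ) (φ : κ → (ι → ℝ) → ℝ) (y : κ → ι → ℝ),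
      (∀ k, ContDiff ℝ (⊤ : ℕ∞) (φ k)) ∧ (∀ k x, 0 ≤ φ k x) ∧
      (∀ k x i, φ k (x + Pi.single i 1) = φ k x) ∧ (∀ x, ∑ k, φ k x = 1) ∧
      ∀ k x, φ k x ≠ 0 → ∃ n : ι → ℤ, ‖x - y k - fun i => (n i : ℝ)‖ ≤ δ := by
  obtain ⟨m, hm⟩ := exists_nat_ge (max 2 (1 / δ))
  have hm2 : 2 ≤ m := by exact_mod_cast (le_max_left _ _).trans hm
  have hmδ : 1 / (m : ℝ) ≤ δ := by
    have := (le_max_right _ _).trans hm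
    rw [div_le_iff₀ hδ] at this
    rw [div_le_iff₀ (by positivity)]
    linarith
  obtain ⟨θ, hs, h0, hp, h1, hsupp⟩ := exists_periodic_partition m hm2
  let e := Fintype.equivFin ι
  refine ⟨Fin (Fintype.card ι) → Fin m, inferInstance, fun k x => ∏ i, θ (k (e i)) (x i),
    fun k i => (k (e i) : ℝ) / m, fun k => ?_, fun k x => ?_, fun k x i => ?_, fun x => ?_,
    fun k x h => ?_⟩
  · exact contDiff_prod fun i _ => (hs _).comp (contDiff_apply ℝ ℝ i)
  · exact Finset.prod_nonneg fun i _ => h0 _ _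
  · refine Finset.prod_congr rfl fun j _ => ?_
    by_cases hj : j = i
    · subst hj; simp [hp]
    · simp [hj]
  · simp only
    have := (Finset.prod_univ_sum (fun _ : Fin (Fintype.card ι) => (Finset.univ : Finset (Fin m)))
      (fun i j => θ j (x (e.symm i)))).symm
    simp only [h1, Finset.prod_const_one, Fintype.piFinset_univ] at this
    rw [← this]
    refine Finset.sum_congr rfl fun k _ => ?_
    exact Fintype.prod_equiv e _ _ fun i => by simp
  · have hne : ∀ i, θ (k (e i)) (x i) ≠ 0 := fun i => by
      exact (Finset.prod_ne_zero_iff.1 h) i (Finset.mem_univ i)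
    choose n hn using fun i => hsupp _ _ (hne i)
    exact ⟨n, (pi_norm_le_iff_of_nonneg hδ.le).2 fun i => (hn i).trans hmδ⟩

/-- Approximate solutions of the backward continuity equation `∂ₜρ + div (ρ V) = 0`, `ρ(T) = 1`,
with `ρ` positive and the momentum `-E` close to `ρ V`. -/
theorem exists_density {ι : Type*} [Fintype ι] [DecidableEq ι] {T : ℝ} (hT : 0 < T)
    {V : ℝ → (ι → ℝ) → ι → ℝ} (hV : Continuous fun q : ℝ × (ι → ℝ) => V q.1 q.2)
    (hper : ∀ t x i, V t (x + Pi.single i 1) = V t x) {ε : ℝ} (hε : 0 < ε) :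
    ∃ (ρ : ℝ → (ι → ℝ) → ℝ) (E : ℝ → (ι → ℝ) → ι → ℝ),
      ContDiff ℝ (⊤ : ℕ∞) (fun q : ℝ × (ι → ℝ) => ρ q.1 q.2) ∧
      ContDiff ℝ (⊤ : ℕ∞) (fun q : ℝ × (ι → ℝ) => E q.1 q.2) ∧
      (∀ t x i, ρ t (x + Pi.single i 1) = ρ t x) ∧
      (∀ t x i, E t (x + Pi.single i 1) = E t x) ∧
      (∀ t x, 0 < ρ t x) ∧ (∀ x, ρ T x = 1) ∧
      (∀ t x, HasDerivAt (fun s => ρ s x)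
        (∑ i, fderiv ℝ (fun y => E t y i) x (Pi.single i 1)) t) ∧
      ∀ t ∈ Set.Icc 0 T, ∀ x i, |E t x i + ρ t x * V t x i| ≤ ε * (ρ t x + 1) := by
  obtain ⟨⟨C, hC0, hC⟩, hu⟩ := periodic_unif T hV hper
  obtain ⟨δ, hδ, hδu⟩ := hu (ε / 2) (by positivity)
  obtain ⟨κ, _, φ, y, hφs, hφ0, hφp, hφ1, hφsupp⟩ := exists_torus_partition ι hδ
  choose X X' hXs hX's hXd hXT hXV using fun k =>
    exists_smooth_trajectory hT hV hper (y k) (ε := ε / 2) (by positivity)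
  obtain ⟨c, hc0, hc1, hcC⟩ : ∃ c : ℝ, 0 < c ∧ c ≤ 1 ∧ c * C ≤ ε :=
    ⟨min 1 (ε / (C + 1)), by positivity, min_le_left _ _, by
      calc min 1 (ε / (C + 1)) * C ≤ ε / (C + 1) * C := by gcongr; exact min_le_right _ _
        _ ≤ ε := by rw [div_mul_eq_mul_div, div_le_iff₀ (by positivity)]; nlinarith⟩
  let w : κ → ℝ → (ι → ℝ) → ℝ := fun k t x => φ k (x - X k t + y k)
  have hws : ∀ k, ContDiff ℝ (⊤ : ℕ∞) fun q : ℝ × (ι → ℝ) => w k q.1 q.2 := fun k =>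
    (hφs k).comp ((contDiff_snd.sub ((hXs k).comp contDiff_fst)).add contDiff_const)
  have hwp : ∀ k t x i, w k t (x + Pi.single i 1) = w k t x := fun k t x i => by
    simp only [w]
    rw [← hφp k (x - X k t + y k) i]
    congr 1
    abel
  have hw0 : ∀ k t x, 0 ≤ w k t x := fun k t x => hφ0 _ _
  let ρ₀ : ℝ → (ι → ℝ) → ℝ := fun t x => ∑ k, w k t x
  have hρ₀ : ∀ t x, 0 ≤ ρ₀ t x := fun t x => Finset.sum_nonneg fun k _ => hw0 k t x
  refine ⟨fun t x => (1 - c) * ρ₀ t x + c, fun t x i => (1 - c) * -∑ k, w k t x * X' k t i,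
    ?_, ?_, fun t x i => ?_, fun t x i => ?_, fun t x => ?_, fun x => ?_, fun t x => ?_,
    fun t ht x i => ?_⟩
  · exact (contDiff_const.mul (ContDiff.sum fun k _ => hws k)).add contDiff_const
  · refine contDiff_pi.2 fun i => contDiff_const.mul (ContDiff.sum fun k _ => ?_).neg
    exact (hws k).mul (((contDiff_apply ℝ ℝ i).comp (hX's k)).comp contDiff_fst)
  · simp only [ρ₀, hwp]
  · simp only [hwp]
  · have := hρ₀ t x
    have : 0 ≤ (1 - c) * ρ₀ t x := mul_nonneg (by linarith) this
    simp only
    linarith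
  · simp [ρ₀, w, hXT, hφ1]
  · have hφd : ∀ k z, HasFDerivAt (φ k) (fderiv ℝ (φ k) z) z := fun k z =>
      ((hφs k).differentiable (by simp) z).hasFDerivAt
    have hwx : ∀ k, HasFDerivAt (fun z => w k t z) (fderiv ℝ (φ k) (x - X k t + y k)) x :=
      fun k => by
        have := (hφd k (x - X k t + y k)).comp x
          (((hasFDerivAt_id x).sub_const (X k t)).add_const (y k))
        rwa [ContinuousLinearMap.comp_id] at this
    have hwt : ∀ k, HasDerivAt (fun s => w k s x)
        (-fderiv ℝ (φ k) (x - X k t + y k) (X' k t)) t := fun k => by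
      have := (hφd k (x - X k t + y k)).comp_hasDerivAt t
        (((hXd k t).const_sub x).add_const (y k))
      rwa [map_neg] at this
    have hE : ∀ i, HasFDerivAt (fun z => (1 - c) * -∑ k, w k t z * X' k t i)
        ((1 - c) • -∑ k, X' k t i • fderiv ℝ (φ k) (x - X k t + y k)) x := fun i =>
      ((HasFDerivAt.fun_sum fun k _ => (hwx k).mul_const (X' k t i)).neg).const_mul (1 - c)
    have hρ := ((HasDerivAt.fun_sum fun k (_ : k ∈ Finset.univ) => hwt k).const_mul
      (1 - c)).add_const c
    refine hρ.congr_deriv ?_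
    have hlin : ∀ k, fderiv ℝ (φ k) (x - X k t + y k) (X' k t)
        = ∑ i, X' k t i * fderiv ℝ (φ k) (x - X k t + y k) (Pi.single i 1) := fun k => by
      conv_lhs => rw [pi_eq_sum_univ' (X' k t)]
      simp [map_sum]
    simp only [(hE _).fderiv]
    simp only [hlin, _root_.smul_apply, _root_.neg_apply,
      _root_.sum_apply, smul_eq_mul]
    rw [← Finset.mul_sum, Finset.sum_neg_distrib, Finset.sum_neg_distrib, Finset.sum_comm]
  · have hk : ∀ k, |w k t x * (V t x i - X' k t i)| ≤ w k t x * ε := fun k => by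
      rw [abs_mul, abs_of_nonneg (hw0 k t x)]
      by_cases h0 : w k t x = 0
      · simp [h0]
      refine mul_le_mul_of_nonneg_left ?_ (hw0 k t x)
      obtain ⟨n, hn⟩ := hφsupp k _ h0
      have hx : V t x = V t (x + fun i => ((-n i : ℤ) : ℝ)) := (periodic_int (hper t) _ x).symm
      have h1 : ‖V t x - V t (X k t)‖ ≤ ε / 2 := by
        rw [hx]
        refine hδu t ht _ _ (le_of_eq_of_le ?_ hn)
        congr 1
        ext j
        simp
        ring
      have h2 : ‖V t x - X' k t‖ ≤ ε := by
        calc ‖V t x - X' k t‖ = ‖(V t x - V t (X k t)) - (X' k t - V t (X k t))‖ := by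
              congr 1; abel
          _ ≤ ε / 2 + ε / 2 := (norm_sub_le _ _).trans (add_le_add h1 (hXV k t ht))
          _ = ε := by ring
      exact (norm_le_pi_norm (V t x - X' k t) i).trans h2
    have hsum : |∑ k, w k t x * (V t x i - X' k t i)| ≤ ρ₀ t x * ε := by
      refine (Finset.abs_sum_le_sum_abs _ _).trans ?_
      simp only [ρ₀]
      rw [Finset.sum_mul]
      exact Finset.sum_le_sum fun k _ => hk k
    have hVi : |V t x i| ≤ C := (norm_le_pi_norm (V t x) i).trans (hC t ht x)
    have e : (1 - c) * -∑ k, w k t x * X' k t i + ((1 - c) * ρ₀ t x + c) * V t x i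
        = (1 - c) * (∑ k, w k t x * (V t x i - X' k t i)) + c * V t x i := by
      simp only [mul_sub, Finset.sum_sub_distrib, ← Finset.sum_mul, ρ₀]
      ring
    simp only
    rw [e]
    refine (abs_add_le _ _).trans ?_
    rw [abs_mul, abs_mul, abs_of_nonneg (show 0 ≤ 1 - c by linarith), abs_of_pos hc0]
    have h3 : (1 - c) * |∑ k, w k t x * (V t x i - X' k t i)| ≤ (1 - c) * (ρ₀ t x * ε) :=
      mul_le_mul_of_nonneg_left hsum (by linarith)
    have h4 : c * |V t x i| ≤ c * C := mul_le_mul_of_nonneg_left hVi hc0.le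
    nlinarith [mul_pos hε hc0]

theorem domST_measure (N p : ℕ) (T : ℝ) : μST N p T =
    ((volume : Measure ℝ).restrict (Set.Ioo 0 T)).prod
      ((volume : Measure (Pt N p)).restrict (cube N p)) := by
  rw [μST, domST, Measure.prod_restrict, Measure.volume_eq_prod]

theorem cube_volume (N p : ℕ) : volume (cube N p) = 1 := by
  simp [cube, volume_pi_pi]

theorem measurableSet_cube (N p : ℕ) : MeasurableSet (cube N p) :=
  MeasurableSet.univ_pi fun _ => measurableSet_Ico

theorem measurableSet_domST (N p : ℕ) (T : ℝ) : MeasurableSet (domST N p T) :=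
  measurableSet_Ioo.prod (measurableSet_cube N p)

theorem domST_subset (N p : ℕ) (T : ℝ) : domST N p T ⊆ Set.Icc 0 T ×ˢ Set.Icc 0 1 :=
  Set.prod_mono Set.Ioo_subset_Icc_self fun _ hx =>
    ⟨fun i => (hx i trivial).1, fun i => (hx i trivial).2.le⟩

theorem integrableOn_domST_of_continuous {N p : ℕ} {T : ℝ} {f : ℝ × Pt N p → ℝ}
    (hf : Continuous f) : IntegrableOn f (domST N p T) :=
  (hf.continuousOn.integrableOn_compact (isCompact_Icc.prod isCompact_Icc)).mono_set
    (domST_subset N p T)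

theorem integral_iterated {N p : ℕ} {T : ℝ} {f : ℝ × Pt N p → ℝ}
    (hf : IntegrableOn f (domST N p T)) :
    ∫ t in Set.Ioo 0 T, ∫ x in cube N p, f (t, x) = ∫ q in domST N p T, f q :=
  (setIntegral_prod f hf).symm

theorem integrableOn_iterated {N p : ℕ} {T : ℝ} {f : ℝ × Pt N p → ℝ}
    (hf : IntegrableOn f (domST N p T)) :
    IntegrableOn (fun t => ∫ x in cube N p, f (t, x)) (Set.Ioo 0 T) := by
  have h : Integrable f (μST N p T) := hf
  rw [domST_measure] at h
  exact h.integral_prod_left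

theorem integral_iterated_add {N p : ℕ} {T : ℝ} {f g : ℝ × Pt N p → ℝ}
    (hf : IntegrableOn f (domST N p T)) (hg : IntegrableOn g (domST N p T)) :
    ∫ t in Set.Ioo 0 T, ((∫ x in cube N p, f (t, x)) + ∫ x in cube N p, g (t, x))
      = ∫ q in domST N p T, (f q + g q) := by
  rw [integral_add (integrableOn_iterated hf) (integrableOn_iterated hg), integral_iterated hf,
    integral_iterated hg, integral_add hf hg]

/-- The integral over the unit cell of a partial derivative of a periodic function vanishes. -/
theorem integral_cube_partial {N p : ℕ} {f : Pt N p → ℝ} (hf : ContDiff ℝ 1 f)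
    (hper : ∀ x i, f (x + Pi.single i 1) = f x) (i : SIdx N p) :
    ∫ x in cube N p, fderiv ℝ f x (Pi.single i 1) = 0 := by
  obtain ⟨n, hn⟩ : ∃ n, Fintype.card (SIdx N p) = n + 1 :=
    Nat.exists_eq_succ_of_ne_zero (Fintype.card_pos_iff.2 ⟨i⟩).ne'
  let e : SIdx N p ≃ Fin (n + 1) := Fintype.equivFinOfCardEq hn
  let eL : Pt N p ≃L[ℝ] (Fin (n + 1) → ℝ) := ContinuousLinearEquiv.piCongrLeft ℝ (fun _ => ℝ) e
  have heL : ∀ x j, eL x (e j) = x j := fun x j =>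
    Equiv.piCongrLeft_apply_apply (fun _ => ℝ) e x j
  have heLs : ∀ y j, eL.symm y j = y (e j) := fun y j => by
    rw [← heL (eL.symm y) j, eL.apply_symm_apply]
  have hsingle : ∀ j : SIdx N p, eL.symm (Pi.single (e j) 1) = Pi.single j (1 : ℝ) := fun j => by
    ext k
    rw [heLs]
    simp [Pi.single_apply]
  have hcube : cube N p =ᵐ[volume] Set.Icc (0 : Pt N p) 1 := Measure.univ_pi_Ico_ae_eq_Icc
  have hcont : Continuous fun x => fderiv ℝ f x (Pi.single i 1) :=
    (hf.continuous_fderiv (by simp)).clm_apply continuous_const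
  rw [setIntegral_congr_set hcube]
  have key := integral_divergence_of_hasFDerivAt_off_countable_of_equiv eL
    (fun x y => ?_) ?_ (fun j => if j = e i then f else 0)
    (fun j x => if j = e i then fderiv ℝ f x else 0) ∅ Set.countable_empty 0 1 zero_le_one
    (fun j => ?_) (fun x _ j => ?_) (fun x => fderiv ℝ f x (Pi.single i 1)) (fun x => ?_)
    (hcont.continuousOn.integrableOn_compact isCompact_Icc)
  · rw [key]
    refine Finset.sum_eq_zero fun j _ => ?_
    by_cases hj : j = e i
    · subst hj
      simp only [if_true]
      rw [sub_eq_zero]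
      refine setIntegral_congr_fun measurableSet_Icc fun y _ => ?_
      rw [← hper (eL.symm ((e i).insertNth (eL 0 (e i)) y)) i]
      congr 1
      apply eL.injective
      rw [map_add, eL.apply_symm_apply, eL.apply_symm_apply, ← hsingle, eL.apply_symm_apply, heL,
        heL]
      ext k
      refine Fin.succAboveCases (e i) ?_ (fun k => ?_) k
      · simp
      · simp
    · simp [hj]
  · constructor
    · intro h k
      have := h (e k)
      rwa [heL, heL] at this
    · intro h k
      obtain ⟨k, rfl⟩ := e.surjective k
      rw [heL, heL]
      exact h k
  · exact volume_measurePreserving_piCongrLeft (fun _ => ℝ) e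
  · by_cases hj : j = e i
    · simpa [hj] using hf.continuous.continuousOn
    · simp only [hj, if_false]
      exact continuousOn_const
  · by_cases hj : j = e i
    · simpa [hj] using (hf.differentiable (by simp) x).hasFDerivAt
    · simp only [hj, if_false]
      exact hasFDerivAt_const (0 : ℝ) x
  · rw [Finset.sum_eq_single (e i)]
    · simp [hsingle]
    · intro j _ hj; simp [hj]
    · simp

theorem hasDerivAt_time {N p : ℕ} {g : ℝ × Pt N p → ℝ} (hg : ContDiff ℝ (⊤ : ℕ∞) g) (t : ℝ)
    (x : Pt N p) : HasDerivAt (fun s => g (s, x)) (fderiv ℝ g (t, x) (1, 0)) t :=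
  (hg.differentiable (by simp) (t, x)).hasFDerivAt.comp_hasDerivAt t
    ((hasDerivAt_id t).prodMk (hasDerivAt_const t x))

theorem hasFDerivAt_space {N p : ℕ} {g : ℝ × Pt N p → ℝ} (hg : ContDiff ℝ (⊤ : ℕ∞) g) (t : ℝ)
    (x : Pt N p) : HasFDerivAt (fun y => g (t, y))
      ((fderiv ℝ g (t, x)).comp (ContinuousLinearMap.inr ℝ ℝ (Pt N p))) x :=
  (hg.differentiable (by simp) (t, x)).hasFDerivAt.comp x (hasFDerivAt_prodMk_right t x)

theorem continuous_fderiv_const {N p : ℕ} {g : ℝ × Pt N p → ℝ} (hg : ContDiff ℝ (⊤ : ℕ∞) g)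
    (w : ℝ × Pt N p) : Continuous fun q => fderiv ℝ g q w :=
  (hg.continuous_fderiv (by simp)).clm_apply continuous_const

theorem integral_domST_time {N p : ℕ} {T : ℝ} (hT : 0 < T) {g : ℝ × Pt N p → ℝ}
    (hg : ContDiff ℝ (⊤ : ℕ∞) g) (h0 : ∀ x, g (0, x) = 0) (h1 : ∀ x, g (T, x) = 0) :
    ∫ q in domST N p T, fderiv ℝ g q (1, 0) = 0 := by
  have hc := continuous_fderiv_const hg (1, 0)
  have hi : Integrable (fun q => fderiv ℝ g q (1, 0)) (μST N p T) :=
    integrableOn_domST_of_continuous hc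
  change ∫ q, fderiv ℝ g q (1, 0) ∂(μST N p T) = 0
  rw [domST_measure] at hi ⊢
  rw [integral_prod_symm _ hi]
  refine integral_eq_zero_of_ae (Filter.Eventually.of_forall fun x => ?_)
  simp only [Pi.zero_apply]
  rw [← integral_Ioc_eq_integral_Ioo, ← intervalIntegral.integral_of_le hT.le,
    intervalIntegral.integral_eq_sub_of_hasDerivAt (fun t _ => hasDerivAt_time hg t x)
      ((hc.comp (by fun_prop : Continuous fun t : ℝ => (t, x))).intervalIntegrable _ _), h0, h1,
    sub_zero]

theorem integral_domST_space {N p : ℕ} {T : ℝ} {g : ℝ × Pt N p → ℝ}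
    (hg : ContDiff ℝ (⊤ : ℕ∞) g) (hper : ∀ t x i, g (t, x + Pi.single i 1) = g (t, x))
    (i : SIdx N p) : ∫ q in domST N p T, fderiv ℝ g q (0, Pi.single i 1) = 0 := by
  rw [← integral_iterated (integrableOn_domST_of_continuous (continuous_fderiv_const hg _))]
  refine integral_eq_zero_of_ae (Filter.Eventually.of_forall fun t => ?_)
  simp only [Pi.zero_apply]
  have h := integral_cube_partial (f := fun y => g (t, y))
    ((hg.comp (contDiff_prodMk_right t)).of_le (by simp)) (hper t) i
  simpa [(hasFDerivAt_space hg t _).fderiv] using h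

/-- Integration by parts for a solution of `∂ₜρ = div E`, `ρ(T) = 1`. -/
theorem integral_continuity_equation {N p : ℕ} {T : ℝ} (hT : 0 < T) {ρ : ℝ → Pt N p → ℝ}
    {E : ℝ → Pt N p → SIdx N p → ℝ}
    (hρ : ContDiff ℝ (⊤ : ℕ∞) fun q : ℝ × Pt N p => ρ q.1 q.2)
    (hE : ContDiff ℝ (⊤ : ℕ∞) fun q : ℝ × Pt N p => E q.1 q.2)
    (hEper : ∀ t x i, E t (x + Pi.single i 1) = E t x) (hρT : ∀ x, ρ T x = 1)
    (hdiv : ∀ t x, HasDerivAt (fun s => ρ s x)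
        (∑ i, fderiv ℝ (fun y => E t y i) x (Pi.single i 1)) t)
    {τ : ℝ × Pt N p → ℝ} (hτ : ContDiff ℝ (⊤ : ℕ∞) τ)
    (hτper : ∀ t x i, τ (t, x + Pi.single i 1) = τ (t, x)) (hτ0 : ∀ x, τ (0, x) = 0) :
    ∫ q in domST N p T, ((ρ q.1 q.2 - 1) * fderiv ℝ τ q (1, 0)
      - ∑ i, E q.1 q.2 i * fderiv ℝ τ q (0, Pi.single i 1)) = 0 := by
  let R : ℝ × Pt N p → ℝ := fun q => ρ q.1 q.2 - 1
  have hR : ContDiff ℝ (⊤ : ℕ∞) R := hρ.sub contDiff_const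
  have hEi : ∀ i, ContDiff ℝ (⊤ : ℕ∞) fun q : ℝ × Pt N p => E q.1 q.2 i := fun i =>
    contDiff_pi.1 hE i
  have hd : ∀ {g : ℝ × Pt N p → ℝ}, ContDiff ℝ (⊤ : ℕ∞) g → Differentiable ℝ g := fun hg =>
    hg.differentiable (by simp)
  have h1 := integral_domST_time hT (hR.mul hτ) (fun x => by simp [hτ0])
    (fun x => by simp [R, hρT])
  have h2 := fun i => integral_domST_space (T := T) ((hEi i).mul hτ)
    (fun t x j => by simp only [hEper, hτper]) i
  have hpt : ∀ q : ℝ × Pt N p, (ρ q.1 q.2 - 1) * fderiv ℝ τ q (1, 0)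
      - ∑ i, E q.1 q.2 i * fderiv ℝ τ q (0, Pi.single i 1)
      = fderiv ℝ (fun q => R q * τ q) q (1, 0)
        - ∑ i, fderiv ℝ (fun q => E q.1 q.2 i * τ q) q (0, Pi.single i 1) := by
    rintro ⟨t, x⟩
    have e1 : fderiv ℝ R (t, x) (1, 0)
        = ∑ i, fderiv ℝ (fun q : ℝ × Pt N p => E q.1 q.2 i) (t, x) (0, Pi.single i 1) := by
      refine (hasDerivAt_time hR t x).unique (((hdiv t x).sub_const 1).congr_deriv ?_)
      refine Finset.sum_congr rfl fun i _ => ?_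
      rw [(hasFDerivAt_space (hEi i) t x).fderiv]
      simp
    rw [fderiv_fun_mul (hd hR _) (hd hτ _)]
    simp only [fun i => fderiv_fun_mul (hd (hEi i) (t, x)) (hd hτ (t, x)), _root_.add_apply,
      _root_.smul_apply, smul_eq_mul, Finset.sum_add_distrib, e1, ← Finset.mul_sum]
    simp only [R]
    ring
  simp only [hpt]
  have hc : ∀ {g : ℝ × Pt N p → ℝ} (w), ContDiff ℝ (⊤ : ℕ∞) g →
      IntegrableOn (fun q => fderiv ℝ g q w) (domST N p T) := fun w hg =>
    integrableOn_domST_of_continuous (continuous_fderiv_const hg w)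
  rw [integral_sub (hc _ (hR.mul hτ)) (integrable_finsetSum _ fun i _ => hc _ ((hEi i).mul hτ)),
    integral_finsetSum _ fun i _ => hc _ ((hEi i).mul hτ)]
  rw [h1, Finset.sum_eq_zero fun i _ => h2 i, sub_zero]

theorem MemL2V.sub {N p : ℕ} {T : ℝ} {f g : ℝ → Pt N p → Vec N p} (hf : MemL2V N p T f)
    (hg : MemL2V N p T g) : MemL2V N p T fun t x => f t x - g t x := by
  have hm : ∀ a, Measurable fun q : ℝ × Pt N p => (f q.1 q.2 - g q.1 q.2) a := fun a =>
    (hf.1 a).sub (hg.1 a)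
  refine ⟨hm, Integrable.mono' ((hf.2.add hg.2).const_mul 2)
    (Finset.measurable_sum _ fun a _ => (hm a).pow_const 2).aestronglyMeasurable
    (Filter.Eventually.of_forall fun q => ?_)⟩
  rw [Real.norm_of_nonneg (Finset.sum_nonneg fun a _ => sq_nonneg _)]
  simp only [Pi.add_apply]
  rw [← Finset.sum_add_distrib, Finset.mul_sum]
  refine Finset.sum_le_sum fun a _ => ?_
  simp only [Pi.sub_apply]
  nlinarith [sq_nonneg (f q.1 q.2 a + g q.1 q.2 a)]

theorem MemL2V.integrableOn_mul {N p : ℕ} {T : ℝ} {f g : ℝ → Pt N p → Vec N p}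
    (hf : MemL2V N p T f) (hg : MemL2V N p T g) (a b : VIdx N p) :
    IntegrableOn (fun q : ℝ × Pt N p => f q.1 q.2 a * g q.1 q.2 b) (domST N p T) := by
  refine Integrable.mono' (hf.2.add hg.2) ((hf.1 a).mul (hg.1 b)).aestronglyMeasurable
    (Filter.Eventually.of_forall fun q => ?_)
  have h1 := Finset.single_le_sum (f := fun a => (f q.1 q.2 a) ^ 2) (fun a _ => sq_nonneg _)
    (Finset.mem_univ a)
  have h2 := Finset.single_le_sum (f := fun a => (g q.1 q.2 a) ^ 2) (fun a _ => sq_nonneg _)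
    (Finset.mem_univ b)
  simp only [Pi.add_apply, Real.norm_eq_abs] at h1 h2 ⊢
  refine le_trans ?_ (add_le_add h1 h2)
  rw [abs_le]
  constructor <;> nlinarith [sq_nonneg (f q.1 q.2 a + g q.1 q.2 b),
    sq_nonneg (f q.1 q.2 a - g q.1 q.2 b), sq_nonneg (f q.1 q.2 a), sq_nonneg (g q.1 q.2 b)]

theorem MemL2V.integrableOn_pairing {N p : ℕ} {T : ℝ} {f g : ℝ → Pt N p → Vec N p}
    (hf : MemL2V N p T f) (hg : MemL2V N p T g) :
    IntegrableOn (fun q : ℝ × Pt N p => ∑ a, f q.1 q.2 a * g q.1 q.2 a) (domST N p T) :=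
  integrable_finsetSum _ fun a _ => hf.integrableOn_mul hg a a

theorem MemL2V.tensorSq {N p : ℕ} {T : ℝ} {f : ℝ → Pt N p → Vec N p} (hf : MemL2V N p T f) :
    MemL1S N p T fun t x => tensorSq N p (f t x) :=
  ⟨fun a b => (hf.1 a).mul (hf.1 b), fun t x => by
      ext a b; simp [NashDual.tensorSq, vecMulVec_apply, mul_comm],
    integrable_finsetSum _ fun a _ => integrable_finsetSum _ fun b _ =>
      (hf.integrableOn_mul hf a b).abs⟩

theorem MemL1S.integrableOn_pairing {N p : ℕ} {T : ℝ} {M B : ℝ → Pt N p → SymM N p}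
    (hM : MemL1S N p T M) (hB : MemLinfS N p T B) :
    IntegrableOn (fun q : ℝ × Pt N p => ∑ a, ∑ b, M q.1 q.2 a b * B q.1 q.2 a b)
      (domST N p T) := by
  obtain ⟨C, hC⟩ := hB.2.2
  refine integrable_finsetSum _ fun a _ => integrable_finsetSum _ fun b _ => ?_
  have hMab : IntegrableOn (fun q : ℝ × Pt N p => M q.1 q.2 a b) (domST N p T) := by
    refine Integrable.mono' hM.2.2 (hM.1 a b).aestronglyMeasurable
      (Filter.Eventually.of_forall fun q => ?_)
    refine le_trans ?_ (Finset.single_le_sum (f := fun a => ∑ b, |M q.1 q.2 a b|)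
      (fun a _ => Finset.sum_nonneg fun b _ => abs_nonneg _) (Finset.mem_univ a))
    exact Finset.single_le_sum (f := fun b => |M q.1 q.2 a b|) (fun b _ => abs_nonneg _)
      (Finset.mem_univ b)
  exact Integrable.mul_bdd (c := C) hMab (hB.1 a b).aestronglyMeasurable
    (hC.mono fun q hq => hq a b)

theorem MemLinfS.one_add_two_smul {N p : ℕ} {T : ℝ} {B : ℝ → Pt N p → SymM N p}
    (hB : MemLinfS N p T B) : MemLinfS N p T fun t x => 1 + 2 • B t x := by
  obtain ⟨hm, hs, C, hC⟩ := hB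
  refine ⟨fun a b => ?_, fun t x => ?_, 1 + 2 * C, hC.mono fun q hq a b => ?_⟩
  · simpa [two_smul] using ((hm a b).add (hm a b)).const_add ((1 : SymM N p) a b)
  · rw [Matrix.IsSymm, transpose_add, transpose_smul, transpose_one, (hs t x).eq]
  · have h1 : |(1 : SymM N p) a b| ≤ 1 := by
      by_cases h : a = b <;> simp [Matrix.one_apply, h]
    have h2 := hq a b
    change |((1 : SymM N p) + 2 • B q.1 q.2) a b| ≤ _
    rw [Matrix.add_apply, Matrix.smul_apply, nsmul_eq_mul, Nat.cast_ofNat]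
    refine (abs_add_le _ _).trans (add_le_add h1 ?_)
    rw [abs_mul, abs_two]
    linarith

theorem MemL2Om.memL2V {N p : ℕ} {f : Pt N p → Vec N p} (hf : MemL2Om N p f) (T : ℝ) :
    MemL2V N p T fun _ x => f x := by
  refine ⟨fun a => (hf.1 a).comp measurable_snd, ?_⟩
  change Integrable _ (μST N p T)
  rw [domST_measure]
  exact Integrable.comp_snd (f := fun x => ∑ a, (f x a) ^ 2) hf.2 _

theorem memL2V_of_continuous {N p : ℕ} {T : ℝ} {f : ℝ → Pt N p → Vec N p}
    (hf : Continuous fun q : ℝ × Pt N p => f q.1 q.2) : MemL2V N p T f :=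
  have h : ∀ a, Continuous fun q : ℝ × Pt N p => f q.1 q.2 a := fun a => continuous_pi_iff.1 hf a
  ⟨fun a => (h a).measurable,
    integrableOn_domST_of_continuous (continuous_finsetSum _ fun a _ => (h a).pow 2)⟩

theorem one_add_two_smul_isotropic {N p : ℕ} (r : ℝ) :
    (1 : SymM N p) + 2 • (((r - 1) / 2) • (1 : SymM N p)) = r • (1 : SymM N p) := by
  rw [← Nat.cast_smul_eq_nsmul ℝ, smul_smul]
  nth_rewrite 1 [← one_smul ℝ (1 : SymM N p)]
  rw [← add_smul]
  congr 1
  push_cast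
  ring

section Objectives

variable {N p : ℕ} {T : ℝ} {v₀ : Pt N p → Vec N p} {vb v E : ℝ → Pt N p → Vec N p}
  {B : ℝ → Pt N p → SymM N p}

theorem weakForm_eq (hv₀ : MemL2Om N p v₀) (hv : MemL2V N p T v) (hE : MemL2V N p T E)
    (hB : MemLinfS N p T B) :
    ∫ t in Set.Ioo 0 T, (pV N p (fun x => v t x - v₀ x) (E t)
        + pM N p (fun x => tensorSq N p (v t x)) (B t))
      = ∫ q in domST N p T, ((∑ a, (v q.1 q.2 - v₀ q.2) a * E q.1 q.2 a)
        + ∑ a, ∑ b, tensorSq N p (v q.1 q.2) a b * B q.1 q.2 a b) :=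
  integral_iterated_add ((hv.sub (hv₀.memL2V T)).integrableOn_pairing hE)
    (hv.tensorSq.integrableOn_pairing hB)

theorem integrableOn_weakForm (hv₀ : MemL2Om N p v₀) (hv : MemL2V N p T v) (hE : MemL2V N p T E)
    (hB : MemLinfS N p T B) :
    IntegrableOn (fun q : ℝ × Pt N p => (∑ a, (v q.1 q.2 - v₀ q.2) a * E q.1 q.2 a)
        + ∑ a, ∑ b, tensorSq N p (v q.1 q.2) a b * B q.1 q.2 a b) (domST N p T) :=
  ((hv.sub (hv₀.memL2V T)).integrableOn_pairing hE).add (hv.tensorSq.integrableOn_pairing hB)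

theorem integrableOn_distance (hv : MemL2V N p T v) (hvb : MemL2V N p T vb) :
    IntegrableOn (fun q : ℝ × Pt N p =>
      (1 / 2) * ∑ a, (v q.1 q.2 - vb q.1 q.2) a * (v q.1 q.2 - vb q.1 q.2) a) (domST N p T) :=
  ((hv.sub hvb).integrableOn_pairing (hv.sub hvb)).const_mul _

theorem primalObj_eq (hv₀ : MemL2Om N p v₀) (hvb : MemL2V N p T vb) (hv : MemL2V N p T v)
    (hE : MemL2V N p T E) (hB : MemLinfS N p T B) :
    primalObj N p T v₀ vb v E B
      = (∫ q in domST N p T,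
          (1 / 2) * ∑ a, (v q.1 q.2 - vb q.1 q.2) a * (v q.1 q.2 - vb q.1 q.2) a)
        + ∫ t in Set.Ioo 0 T, (pV N p (fun x => v t x - v₀ x) (E t)
          + pM N p (fun x => tensorSq N p (v t x)) (B t)) := by
  have h1 := integrableOn_distance hv hvb
  have h2 := (hv.sub (hv₀.memL2V T)).integrableOn_pairing hE
  have h3 := hv.tensorSq.integrableOn_pairing hB
  rw [← integral_iterated h1]
  refine Eq.trans ?_ (integral_add (integrableOn_iterated h1)
    ((integrableOn_iterated h2).add (integrableOn_iterated h3)))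
  simp only [primalObj, pV, pM, integral_const_mul, add_assoc]

theorem integrableOn_dualData (hv₀ : MemL2Om N p v₀) (hvb : MemL2V N p T vb)
    (hE : MemL2V N p T E) :
    IntegrableOn (fun q : ℝ × Pt N p => (-∑ a, v₀ q.2 a * E q.1 q.2 a)
      + (1 / 2) * ∑ a, vb q.1 q.2 a * vb q.1 q.2 a) (domST N p T) :=
  ((hv₀.memL2V T).integrableOn_pairing hE).neg.add ((hvb.integrableOn_pairing hvb).const_mul _)

theorem dualData_eq (hv₀ : MemL2Om N p v₀) (hvb : MemL2V N p T vb) (hE : MemL2V N p T E) :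
    ∫ t in Set.Ioo 0 T, (-pV N p (fun x => v₀ x) (E t) + (1 / 2) * pV N p (vb t) (vb t))
      = ∫ q in domST N p T, ((-∑ a, v₀ q.2 a * E q.1 q.2 a)
        + (1 / 2) * ∑ a, vb q.1 q.2 a * vb q.1 q.2 a) := by
  refine Eq.trans ?_ (integral_iterated_add ((hv₀.memL2V T).integrableOn_pairing hE).neg
    ((hvb.integrableOn_pairing hvb).const_mul _))
  simp only [pV, integral_neg, integral_const_mul]

theorem integrableOn_kernel {z Q : ℝ → Pt N p → Vec N p} {M : ℝ → Pt N p → SymM N p}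
    (hz : MemL2V N p T z) (hQ : MemL2V N p T Q) (hM : MemL1S N p T M) (hB : MemLinfS N p T B) :
    IntegrableOn (fun q : ℝ × Pt N p => (∑ a, z q.1 q.2 a * Q q.1 q.2 a)
      + (1 / 2) * ∑ a, ∑ b, M q.1 q.2 a b * ((1 : SymM N p) + 2 • B q.1 q.2) a b) (domST N p T) :=
  (hz.integrableOn_pairing hQ).add ((hM.integrableOn_pairing hB.one_add_two_smul).const_mul _)

theorem kernel_eq {z Q : ℝ → Pt N p → Vec N p} {M : ℝ → Pt N p → SymM N p}
    (hz : MemL2V N p T z) (hQ : MemL2V N p T Q) (hM : MemL1S N p T M) (hB : MemLinfS N p T B) :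
    ∫ t in Set.Ioo 0 T, (pV N p (z t) (Q t) + (1 / 2) * pM N p (M t) (fun x => 1 + 2 • B t x))
      = ∫ q in domST N p T, ((∑ a, z q.1 q.2 a * Q q.1 q.2 a)
        + (1 / 2) * ∑ a, ∑ b, M q.1 q.2 a b * ((1 : SymM N p) + 2 • B q.1 q.2) a b) := by
  rw [← integral_iterated_add (hz.integrableOn_pairing hQ)
    ((hM.integrableOn_pairing hB.one_add_two_smul).const_mul _)]
  simp only [pV, pM, integral_const_mul]

/-- Weak duality. -/
theorem dualObj_le_Ifun (hv₀ : MemL2Om N p v₀) (hvb : MemL2V N p T vb)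
    (hEB : Admissible N p T E B) : dualObj N p T v₀ vb E B ≤ Ifun N p T v₀ vb := by
  refine le_iInf fun ⟨w, hw⟩ => ?_
  refine le_trans ?_ (le_iSup _ (⟨(E, B), hEB⟩ : {EB : (ℝ → Pt N p → Vec N p) ×
    (ℝ → Pt N p → SymM N p) // Admissible N p T EB.1 EB.2}))
  have hK := iInf_le (fun zM : {zM : (ℝ → Pt N p → Vec N p) × (ℝ → Pt N p → SymM N p) //
      MemL2V N p T zM.1 ∧ MemL1S N p T zM.2 ∧
      ∀ᵐ q ∂(μST N p T), (zM.2 q.1 q.2 - tensorSq N p (zM.1 q.1 q.2)).PosSemidef} =>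
      ((∫ t in Set.Ioo 0 T, (pV N p (zM.1.1 t) (fun x => E t x - vb t x)
          + (1 / 2) * pM N p (zM.1.2 t) (fun x => 1 + 2 • B t x)) : ℝ) : EReal))
    ⟨(w, fun t x => tensorSq N p (w t x)), hw, hw.tensorSq,
      Filter.Eventually.of_forall fun q => by simpa using Matrix.PosSemidef.zero⟩
  refine (add_le_add_right hK _).trans (le_of_eq ?_)
  rw [← EReal.coe_add]
  congr 1
  simp only
  rw [dualData_eq hv₀ hvb hEB.1, kernel_eq hw (hEB.1.sub hvb) hw.tensorSq hEB.2.1,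
    primalObj_eq hv₀ hvb hw hEB.1 hEB.2.1, weakForm_eq hv₀ hw hEB.1 hEB.2.1,
    ← integral_add (integrableOn_dualData hv₀ hvb hEB.1)
      (integrableOn_kernel hw (hEB.1.sub hvb) hw.tensorSq hEB.2.1),
    ← integral_add (integrableOn_distance hw hvb)
      (integrableOn_weakForm hv₀ hw hEB.1 hEB.2.1)]
  congr 1
  ext q
  have e : ∑ a, ∑ b, tensorSq N p (w q.1 q.2) a b * ((1 : SymM N p) + 2 • B q.1 q.2) a b
      = ∑ a, w q.1 q.2 a * w q.1 q.2 a
        + 2 * ∑ a, ∑ b, tensorSq N p (w q.1 q.2) a b * B q.1 q.2 a b := by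
    have e2 : ∀ a b, ((1 : SymM N p) + 2 • B q.1 q.2) a b
        = (1 : SymM N p) a b + 2 * B q.1 q.2 a b := fun a b => by
      rw [Matrix.add_apply, Matrix.smul_apply, nsmul_eq_mul, Nat.cast_ofNat]
    simp only [e2, mul_add, Finset.sum_add_distrib, Finset.mul_sum]
    congr 1
    · simp [Matrix.one_apply, tensorSq, vecMulVec_apply]
    · exact Finset.sum_congr rfl fun a _ => Finset.sum_congr rfl fun b _ => by ring
  rw [e]
  simp only [Pi.sub_apply, mul_sub, sub_mul, Finset.sum_sub_distrib, mul_comm (vb q.1 q.2 _)]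
  ring

theorem Ifun_le_of_weakSolution (hv₀ : MemL2Om N p v₀) (hvb : MemL2V N p T vb)
    (hv : WeakSolution N p T v₀ v) :
    Ifun N p T v₀ vb ≤ ((∫ q in domST N p T,
      (1 / 2) * ∑ a, (v q.1 q.2 - vb q.1 q.2) a * (v q.1 q.2 - vb q.1 q.2) a : ℝ) : EReal) := by
  refine (iInf_le _ (⟨v, hv.1⟩ : {v : ℝ → Pt N p → Vec N p // MemL2V N p T v})).trans
    (iSup_le fun ⟨⟨E, B⟩, hEB⟩ => ?_)
  rw [primalObj_eq hv₀ hvb hv.1 hEB.1 hEB.2.1, hv.2 E B hEB, add_zero]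

/-- The dual objective attains the primal value at an isotropic pair compatible with `v`. -/
theorem le_dualObj_of_weakSolution (hv₀ : MemL2Om N p v₀) (hvb : MemL2V N p T vb)
    (hv : WeakSolution N p T v₀ v) {ρ : ℝ → Pt N p → ℝ} (hρ : ∀ t x, 0 < ρ t x)
    (hB : ∀ t x, B t x = ((ρ t x - 1) / 2) • (1 : SymM N p)) (hEB : Admissible N p T E B)
    (hvbE : ∀ t ∈ Set.Ioo 0 T, ∀ x, vb t x = E t x + ρ t x • v t x) :
    ((∫ q in domST N p T,
      (1 / 2) * ∑ a, (v q.1 q.2 - vb q.1 q.2) a * (v q.1 q.2 - vb q.1 q.2) a : ℝ) : EReal)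
      ≤ dualObj N p T v₀ vb E B := by
  set P := ∫ q in domST N p T,
      (1 / 2) * ∑ a, (v q.1 q.2 - vb q.1 q.2) a * (v q.1 q.2 - vb q.1 q.2) a with hP
  have hw := hv.2 E B hEB
  rw [weakForm_eq hv₀ hv.1 hEB.1 hEB.2.1] at hw
  rw [dualObj, dualData_eq hv₀ hvb hEB.1]
  set c := ∫ q in domST N p T, ((-∑ a, v₀ q.2 a * E q.1 q.2 a)
        + (1 / 2) * ∑ a, vb q.1 q.2 a * vb q.1 q.2 a) with hc
  have hPc : (P : EReal) = (c : EReal) + ((P - c : ℝ) : EReal) := by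
    rw [← EReal.coe_add]; congr 1; ring
  rw [hPc]
  refine add_le_add_right (le_iInf fun ⟨⟨z, M⟩, hz, hM, hzM⟩ => ?_) _
  rw [EReal.coe_le_coe_iff]
  simp only
  rw [kernel_eq hz (hEB.1.sub hvb) hM hEB.2.1, sub_le_iff_le_add, ← add_zero P, ← hw, hP, hc,
    ← integral_add (integrableOn_distance hv.1 hvb) (integrableOn_weakForm hv₀ hv.1 hEB.1 hEB.2.1),
    ← integral_add (integrableOn_kernel hz (hEB.1.sub hvb) hM hEB.2.1)
      (integrableOn_dualData hv₀ hvb hEB.1)]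
  refine integral_mono_ae ((integrableOn_distance hv.1 hvb).add
    (integrableOn_weakForm hv₀ hv.1 hEB.1 hEB.2.1))
    ((integrableOn_kernel hz (hEB.1.sub hvb) hM hEB.2.1).add
      (integrableOn_dualData hv₀ hvb hEB.1)) ?_
  filter_upwards [hzM, ae_restrict_mem (measurableSet_domST N p T)] with q hq hqd
  have hI : (1 : SymM N p) + 2 • B q.1 q.2 = ρ q.1 q.2 • (1 : SymM N p) := by
    rw [hB, one_add_two_smul_isotropic]
  rw [hI]
  have hdiag : ∀ (A : SymM N p) (r : ℝ), ∑ a, ∑ b, A a b * (r • (1 : SymM N p)) a b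
      = ∑ a, r * A a a := fun A r => by
    simp [Matrix.one_apply, mul_comm]
  rw [hB, hdiag, hdiag, ← Finset.sum_neg_distrib]
  simp only [Finset.mul_sum, ← Finset.sum_add_distrib]
  refine Finset.sum_le_sum fun a _ => ?_
  have hMa : z q.1 q.2 a * z q.1 q.2 a ≤ M q.1 q.2 a a := by
    have := hq.diag_nonneg (i := a)
    simpa [tensorSq, vecMulVec_apply] using this
  have hva : vb q.1 q.2 a = E q.1 q.2 a + ρ q.1 q.2 * v q.1 q.2 a := by
    rw [hvbE q.1 hqd.1 q.2]; simp
  simp only [Pi.sub_apply, tensorSq, vecMulVec_apply]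
  rw [hva]
  have hr := hρ q.1 q.2
  nlinarith [mul_nonneg hr.le (sq_nonneg (v q.1 q.2 a - z q.1 q.2 a)),
    mul_le_mul_of_nonneg_left hMa hr.le]

end Objectives

theorem sum_VIdx_one {p : ℕ} (f : VIdx 1 p → ℝ) : ∑ a, f a = ∑ i : SIdx 1 p, f (0, i) := by
  simp [Fintype.sum_prod_type]

/-- The constraint holds for the isotropic pair built from a solution of the continuity equation. -/
theorem constraintEB_of_continuity_equation {p : ℕ} {T : ℝ} (hT : 0 < T) {ρ : ℝ → Pt 1 p → ℝ}
    {E : ℝ → Pt 1 p → SIdx 1 p → ℝ}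
    (hρ : ContDiff ℝ (⊤ : ℕ∞) fun q : ℝ × Pt 1 p => ρ q.1 q.2)
    (hE : ContDiff ℝ (⊤ : ℕ∞) fun q : ℝ × Pt 1 p => E q.1 q.2)
    (hEper : ∀ t x i, E t (x + Pi.single i 1) = E t x) (hρT : ∀ x, ρ T x = 1)
    (hdiv : ∀ t x, HasDerivAt (fun s => ρ s x)
        (∑ i, fderiv ℝ (fun y => E t y i) x (Pi.single i 1)) t) :
    ConstraintEB 1 p T (fun t x a => E t x a.2)
      (fun t x => ((ρ t x - 1) / 2) • (1 : SymM 1 p)) := by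
  rintro Ψ ⟨hΨs, hΨp, -, hΨ0⟩
  let τ : ℝ × Pt 1 p → ℝ := fun q => mfU 1 p (Ψ q.1 q.2) 0
  have hτ_eq : ∀ q, τ q = (1 / 2) * ∑ a : VIdx 1 p, Ψ q.1 q.2 a a := fun q => by
    have hempty : (Finset.univ.filter fun j : Fin 1 => j ≠ 0) = ∅ := by decide
    simp only [τ, mfU, hempty, Finset.sum_empty, add_zero]
    simp [Fintype.sum_prod_type]
  have hτ : ContDiff ℝ (⊤ : ℕ∞) τ := by
    rw [funext hτ_eq]
    exact contDiff_const.mul (ContDiff.sum fun a _ => hΨs a a)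
  have key := integral_continuity_equation hT hρ hE hEper hρT hdiv hτ
    (fun t x i => by simp only [τ, hΨp]) (fun x => by simp [hτ_eq, hΨ0])
  have hρc : Continuous fun q : ℝ × Pt 1 p => ρ q.1 q.2 := hρ.continuous
  have hEc : ∀ i, Continuous fun q : ℝ × Pt 1 p => E q.1 q.2 i := fun i =>
    continuous_pi_iff.1 hE.continuous i
  refine Eq.trans ?_ key
  have h1 : IntegrableOn (fun q : ℝ × Pt 1 p => (ρ q.1 q.2 - 1) * fderiv ℝ τ q (1, 0))
      (domST 1 p T) := integrableOn_domST_of_continuous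
    ((hρc.sub continuous_const).mul (continuous_fderiv_const hτ _))
  have h2 : IntegrableOn (fun q : ℝ × Pt 1 p =>
      -∑ i, E q.1 q.2 i * fderiv ℝ τ q (0, Pi.single i 1)) (domST 1 p T) :=
    integrableOn_domST_of_continuous (continuous_finsetSum _ fun i _ =>
      (hEc i).mul (continuous_fderiv_const hτ _)).neg
  simp only [sub_eq_add_neg (_ * _)]
  rw [← integral_iterated_add h1 h2]
  refine integral_congr_ae (Filter.Eventually.of_forall fun t =>
    congrArg₂ (HAdd.hAdd (α := ℝ) (β := ℝ)) ?_ ?_)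
  · simp only [pM]
    refine integral_congr_ae (Filter.Eventually.of_forall fun x => ?_)
    beta_reduce
    have hd : HasDerivAt (fun s => τ (s, x))
        ((1 / 2) * ∑ a : VIdx 1 p, deriv (fun s => Ψ s x a a) t) t := by
      simp only [hτ_eq]
      refine (HasDerivAt.fun_sum fun a _ => ?_).const_mul _
      exact (hasDerivAt_time (hΨs a a) t x).differentiableAt.hasDerivAt
    rw [(hasDerivAt_time hτ t x).unique hd]
    have hdiag : ∀ A : SymM 1 p, ∀ r : ℝ, ∑ a, ∑ b, (r • (1 : SymM 1 p)) a b * A a b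
        = r * ∑ a, A a a := fun A r => by
      simp [Matrix.one_apply, Finset.mul_sum]
    rw [hdiag]
    simp only [dtPsi, Matrix.of_apply]
    ring
  · simp only [pV]
    refine integral_congr_ae (Filter.Eventually.of_forall fun x => ?_)
    beta_reduce
    rw [sum_VIdx_one, ← Finset.sum_neg_distrib]
    refine Finset.sum_congr rfl fun i _ => ?_
    have hd := (hasFDerivAt_space hτ t x).fderiv
    simp only [τ] at hd
    simp only [Lop, hd]
    simp [τ]

/-- A continuous periodic velocity admits isotropic admissible pairs whose base state is small. -/
theorem exists_small_baseState {p : ℕ} {T : ℝ} (hT : 0 < T) {V : ℝ → Pt 1 p → Vec 1 p}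
    (hV : Continuous fun q : ℝ × Pt 1 p => V q.1 q.2)
    (hper : ∀ t x i, V t (x + Pi.single i 1) = V t x) {ε : ℝ} (hε : 0 < ε) :
    ∃ (ρ : ℝ → Pt 1 p → ℝ) (E : ℝ → Pt 1 p → Vec 1 p),
      ContDiff ℝ (⊤ : ℕ∞) (fun q : ℝ × Pt 1 p => ρ q.1 q.2) ∧
      ContDiff ℝ (⊤ : ℕ∞) (fun q : ℝ × Pt 1 p => E q.1 q.2) ∧
      (∀ t x i, ρ t (x + Pi.single i 1) = ρ t x) ∧
      (∀ t x i, E t (x + Pi.single i 1) = E t x) ∧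
      (∀ t x, 0 < ρ t x) ∧
      Admissible 1 p T E (fun t x => ((ρ t x - 1) / 2) • (1 : SymM 1 p)) ∧
      ∫ q in domST 1 p T, Real.sqrt (∑ a, ((E q.1 q.2 + ρ q.1 q.2 • V q.1 q.2) a) ^ 2)
        ≤ ε * (2 * T * p) := by
  obtain ⟨ρ, E, hρ, hE, hρp, hEp, hρ0, hρT, hdiv, hest⟩ := exists_density hT
    (V := fun t x i => V t x (0, i))
    (continuous_pi fun i => continuous_pi_iff.1 hV (0, i)) (fun t x i => by simp only [hper]) hε
  have hρc : Continuous fun q : ℝ × Pt 1 p => ρ q.1 q.2 := hρ.continuous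
  have hEs : ContDiff ℝ (⊤ : ℕ∞) (fun (q : ℝ × Pt 1 p) (a : VIdx 1 p) => E q.1 q.2 a.2) :=
    contDiff_pi.2 fun a => contDiff_pi.1 hE a.2
  refine ⟨ρ, fun t x a => E t x a.2, hρ, hEs, hρp, fun t x i => by simp only [hEp], hρ0,
    ⟨memL2V_of_continuous hEs.continuous, ⟨fun a b => ?_, fun t x => ?_, ?_⟩,
      constraintEB_of_continuity_equation hT hρ hE hEp hρT hdiv⟩, ?_⟩
  · exact ((hρc.measurable.sub_const 1).div_const 2).mul_const ((1 : SymM 1 p) a b)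
  · rw [Matrix.IsSymm, transpose_smul, transpose_one]
  · obtain ⟨C, hC⟩ := (isCompact_Icc.prod isCompact_Icc : IsCompact
      (Set.Icc 0 T ×ˢ Set.Icc (0 : Pt 1 p) 1)).exists_bound_of_continuousOn
      ((hρc.sub continuous_const).div_const 2 : Continuous fun q : ℝ × Pt 1 p =>
        (ρ q.1 q.2 - 1) / 2).continuousOn
    refine ⟨C, (ae_restrict_mem (measurableSet_domST 1 p T)).mono fun q hq a b => ?_⟩
    have h := hC q (domST_subset 1 p T hq)
    change |(ρ q.1 q.2 - 1) / 2 * (1 : SymM 1 p) a b| ≤ C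
    by_cases hab : a = b
    · rw [hab, Matrix.one_apply_eq, mul_one]
      exact h
    · simpa [Matrix.one_apply, hab] using (norm_nonneg _).trans h
  · have hmass : ∫ q in domST 1 p T, (ρ q.1 q.2 - 1) = 0 := by
      have h := integral_continuity_equation hT hρ hE hEp hρT hdiv (τ := Prod.fst) contDiff_fst
        (fun _ _ _ => rfl) (fun _ => rfl)
      simpa [fderiv_fst] using h
    have hvol : volume.real (domST 1 p T) = T := by
      rw [Measure.real, domST, Measure.volume_eq_prod, Measure.prod_prod, cube_volume]
      simp [hT.le]
    have hone : IntegrableOn (fun _ : ℝ × Pt 1 p => (1 : ℝ)) (domST 1 p T) :=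
      integrableOn_domST_of_continuous continuous_const
    have hmass' : ∫ q in domST 1 p T, (ρ q.1 q.2 + 1) = 2 * T := by
      have e : ∀ q : ℝ × Pt 1 p, ρ q.1 q.2 + 1 = (ρ q.1 q.2 - 1) + 2 * 1 := fun q => by ring
      simp only [e]
      have hsub : IntegrableOn (fun q : ℝ × Pt 1 p => ρ q.1 q.2 - 1) (domST 1 p T) :=
        integrableOn_domST_of_continuous (hρc.sub continuous_const)
      rw [integral_add hsub (hone.const_mul 2), hmass]
      simp [hvol, mul_comm]
    calc _ ≤ ∫ q in domST 1 p T, (ε * p) * (ρ q.1 q.2 + 1) := by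
          refine setIntegral_mono_on (integrableOn_domST_of_continuous ?_)
            (integrableOn_domST_of_continuous (continuous_const.mul (hρc.add continuous_const)))
            (measurableSet_domST 1 p T) fun q hq => ?_
          · exact (continuous_finsetSum _ fun a _ => (continuous_pi_iff.1
              (hEs.continuous.add (hρc.smul hV)) a).pow 2).sqrt
          · refine Real.sqrt_le_iff.2 ⟨?_, ?_⟩
            · have := hρ0 q.1 q.2
              positivity
            · have hcard : (p : ℝ) ≤ (p : ℝ) ^ 2 := by
                exact_mod_cast Nat.le_self_pow two_ne_zero p
              rw [sum_VIdx_one]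
              calc _ ≤ ∑ _i : SIdx 1 p, (ε * (ρ q.1 q.2 + 1)) ^ 2 :=
                    Finset.sum_le_sum fun i _ => sq_le_sq.2 <|
                      (hest q.1 ⟨hq.1.1.le, hq.1.2.le⟩ q.2 i).trans (le_abs_self _)
                _ = p * (ε * (ρ q.1 q.2 + 1)) ^ 2 := by simp
                _ ≤ (p : ℝ) ^ 2 * (ε * (ρ q.1 q.2 + 1)) ^ 2 :=
                    mul_le_mul_of_nonneg_right hcard (sq_nonneg _)
                _ = (ε * p * (ρ q.1 q.2 + 1)) ^ 2 := by ring
      _ = ε * (2 * T * p) := by rw [integral_const_mul, hmass']; ring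

/-- Corollary 2.5 of the paper. Let `N = 1` (hence `n = p`), let
`v₀ ∈ L²(Ω;ℝⁿ)` be continuous, and let `v` be a continuous weak solution of
`∂_t v + ∇𝔘(v⊗v) = 0`, `v(0)=v₀` (the gradient of the viscosity solution of the quadratic
Hamilton–Jacobi equation). Then there is a sequence `v̄_m` of continuous base states with:
(i) `v̄_m → 0` strongly in `L¹((0,T)×Ω;ℝⁿ)`;
(ii) `ℐ(v₀,v̄_m,T) = 𝒥(v₀,v̄_m,T)` for every `m`;
(iii) for every `m` the dual problem has a smooth maximizer `(E_m,B_m)` with `I+2B_m ≻ 0`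
everywhere in `(0,T)×Ω`;
(iv) `v = (I+2B_m)⁻¹(v̄_m − E_m)` everywhere in `(0,T)×Ω`. -/
theorem stmt1 (p : ℕ) (hp : 1 ≤ p) (T : ℝ) (hT : 0 < T)
    (v₀ : Pt 1 p → Vec 1 p) (hv₀ : MemL2Om 1 p v₀) (hv₀c : Continuous v₀)
    (hv₀per : ∀ x i, v₀ (x + Pi.single i 1) = v₀ x)
    (v : ℝ → Pt 1 p → Vec 1 p) (hv : WeakSolution 1 p T v₀ v)
    (hvc : ContinuousOn (fun q : ℝ × Pt 1 p => v q.1 q.2)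
      ((Set.Icc 0 T) ×ˢ (Set.univ : Set (Pt 1 p))))
    (hvper : ∀ t x i, v t (x + Pi.single i 1) = v t x) :
    ∃ vb : ℕ → ℝ → Pt 1 p → Vec 1 p,
      (∀ m, Continuous fun q : ℝ × Pt 1 p => vb m q.1 q.2) ∧
      (∀ m t x i, vb m t (x + Pi.single i 1) = vb m t x) ∧
      Filter.Tendsto
        (fun m => ∫ q in domST 1 p T, Real.sqrt (∑ a, (vb m q.1 q.2 a) ^ 2))
        Filter.atTop (nhds 0) ∧
      (∀ m, Ifun 1 p T v₀ (vb m) = Jfun 1 p T v₀ (vb m)) ∧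
      (∀ m, ∃ (E : ℝ → Pt 1 p → Vec 1 p) (B : ℝ → Pt 1 p → SymM 1 p),
        (∀ a, ContDiff ℝ (⊤ : ℕ∞) fun q : ℝ × Pt 1 p => E q.1 q.2 a) ∧
        (∀ a b, ContDiff ℝ (⊤ : ℕ∞) fun q : ℝ × Pt 1 p => B q.1 q.2 a b) ∧
        DualAdmissible 1 p T E B ∧
        (∀ t ∈ Set.Ioo 0 T, ∀ x, ((1 : SymM 1 p) + 2 • B t x).PosDef) ∧
        dualObj 1 p T v₀ (vb m) E B = Jfun 1 p T v₀ (vb m) ∧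
        ∀ t ∈ Set.Ioo 0 T, ∀ x,
          v t x = ((1 + 2 • B t x)⁻¹).mulVec (vb m t x - E t x)) := by
  let V : ℝ → Pt 1 p → Vec 1 p := fun t x => v (max 0 (min t T)) x
  have hV : Continuous fun q : ℝ × Pt 1 p => V q.1 q.2 := by
    refine hvc.comp_continuous (f := fun q : ℝ × Pt 1 p => (max 0 (min q.1 T), q.2))
      (by fun_prop) fun q => ⟨⟨le_max_left _ _, max_le hT.le (min_le_right _ _)⟩, trivial⟩
  have hVv : ∀ t ∈ Set.Ioo 0 T, ∀ x, V t x = v t x := fun t ht x => by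
    simp only [V, min_eq_left ht.2.le, max_eq_right ht.1.le]
  choose ρ E hρ hE hρp hEp hρ0 hadm hsmall using fun m : ℕ =>
    exists_small_baseState hT hV (fun t x i => hvper _ x i) (ε := 1 / ((m : ℝ) + 1))
      Nat.one_div_pos_of_nat
  let B : ℕ → ℝ → Pt 1 p → SymM 1 p := fun m t x => ((ρ m t x - 1) / 2) • (1 : SymM 1 p)
  let vb : ℕ → ℝ → Pt 1 p → Vec 1 p := fun m t x => E m t x + ρ m t x • V t x
  have hvbc : ∀ m, Continuous fun q : ℝ × Pt 1 p => vb m q.1 q.2 := fun m =>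
    (hE m).continuous.add ((hρ m).continuous.smul hV)
  have hvb : ∀ m, MemL2V 1 p T (vb m) := fun m => memL2V_of_continuous (hvbc m)
  have hI : ∀ m t x, (1 : SymM 1 p) + 2 • B m t x = ρ m t x • (1 : SymM 1 p) := fun m t x =>
    one_add_two_smul_isotropic _
  have hpd : ∀ m t x, ((1 : SymM 1 p) + 2 • B m t x).PosDef := fun m t x => by
    rw [hI]
    exact Matrix.PosDef.one.smul (hρ0 m t x)
  have hdual : ∀ m, DualAdmissible 1 p T (E m) (B m) := fun m =>
    ⟨hadm m, Filter.Eventually.of_forall fun q => (hpd m q.1 q.2).posSemidef⟩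
  have hle : ∀ m, Jfun 1 p T v₀ (vb m) ≤ Ifun 1 p T v₀ (vb m) := fun m =>
    iSup_le fun EB => dualObj_le_Ifun hv₀ (hvb m) EB.2.1
  have hge : ∀ m, Ifun 1 p T v₀ (vb m) ≤ dualObj 1 p T v₀ (vb m) (E m) (B m) := fun m =>
    (Ifun_le_of_weakSolution hv₀ (hvb m) hv).trans
      (le_dualObj_of_weakSolution hv₀ (hvb m) hv (hρ0 m) (fun _ _ => rfl) (hadm m)
        fun t ht x => by simp only [vb, hVv t ht x])
  have hJ : ∀ m, dualObj 1 p T v₀ (vb m) (E m) (B m) ≤ Jfun 1 p T v₀ (vb m) := fun m =>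
    le_iSup (fun EB : {EB : (ℝ → Pt 1 p → Vec 1 p) × (ℝ → Pt 1 p → SymM 1 p) //
      DualAdmissible 1 p T EB.1 EB.2} => dualObj 1 p T v₀ (vb m) EB.1.1 EB.1.2)
      ⟨(E m, B m), hdual m⟩
  refine ⟨vb, hvbc, fun m t x i => ?_, ?_, fun m => le_antisymm ((hge m).trans (hJ m)) (hle m),
    fun m => ⟨E m, B m, contDiff_pi.1 (hE m), fun a b => ?_, hdual m, fun t _ x => hpd m t x,
      le_antisymm (hJ m) ((hle m).trans (hge m)), fun t ht x => ?_⟩⟩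
  · simp only [vb, V, hρp, hEp, hvper]
  · refine squeeze_zero (fun m => integral_nonneg fun q => Real.sqrt_nonneg _) hsmall ?_
    simpa using tendsto_one_div_add_atTop_nhds_zero_nat.mul_const (2 * T * (p : ℝ))
  · exact (((hρ m).sub contDiff_const).div_const 2).mul contDiff_const
  · have hne := (hρ0 m t x).ne'
    have hinv : ((1 : SymM 1 p) + 2 • B m t x)⁻¹ = (ρ m t x)⁻¹ • (1 : SymM 1 p) := by
      rw [hI]
      refine Matrix.inv_eq_left_inv ?_
      rw [Matrix.smul_mul, Matrix.one_mul, smul_smul, inv_mul_cancel₀ hne, one_smul]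
    rw [hinv]
    simp only [vb, hVv t ht x, add_sub_cancel_left, Matrix.smul_mulVec, Matrix.one_mulVec,
      smul_smul, inv_mul_cancel₀ hne, one_smul]

end NashDual
end

section
/- Assume N ≥ 2. Let k ≥ 0 and y ∈ ℝ^N be such that the matrix k·Iₙ + 𝔘*(y) is positive semidefinite. Then for every pair of indices i ≠ j in {1,…,N}, one has (y_j)² ≤ 4k² + 2k·y_i. -/
open Matrix

/-- Index type for the components of the unknown of the noise-free Nash system:
triples `(i,j,l)` with `i,j ∈ {1,…,N}`, `l ∈ {1,…,p}`; `n = pN²`. -/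
abbrev VIdx (N p : ℕ) := Fin N × Fin N × Fin p

/-- Symmetric (as used) `n×n` matrices indexed by the triples. -/
abbrev SymM (N p : ℕ) := Matrix (VIdx N p) (VIdx N p) ℝ

/-- The linear map `𝔘 : Sym(n,ℝ) → ℝ^N`,
`(𝔘A)_i = ½ Σ_l [A_{(i,i,l),(i,i,l)} + Σ_{j≠i} (A_{(j,j,l),(i,j,l)} + A_{(i,j,l),(j,j,l)})]`. -/
noncomputable def mfU (N p : ℕ) (A : SymM N p) (i : Fin N) : ℝ :=
  (1 / 2) * ∑ l : Fin p, (A (i, i, l) (i, i, l)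
    + ∑ j ∈ Finset.univ.filter (fun j => j ≠ i), (A (j, j, l) (i, j, l) + A (i, j, l) (j, j, l)))

/-- `S` is the value at `y` of the adjoint `𝔘* : ℝ^N → Sym(n,ℝ)`: `S` is symmetric and
`⟨𝔘A, y⟩ = ⟨A, S⟩_F` for every symmetric `A`. -/
def IsAdjointU (N p : ℕ) (y : Fin N → ℝ) (S : SymM N p) : Prop :=
  S.IsSymm ∧ ∀ A : SymM N p, A.IsSymm →
    (∑ i, mfU N p A i * y i) = ∑ a, ∑ b, A a b * S a b

/-- Testing the adjoint against the symmetrised elementary matrix reads off one entry. -/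
theorem IsAdjointU.two_mul_apply {N p : ℕ} {y : Fin N → ℝ} {S : SymM N p}
    (hS : IsAdjointU N p y S) (a b : VIdx N p) :
    2 * S a b = ∑ m, mfU N p (single a b 1 + single b a 1) m * y m := by
  have hsymm : (single a b 1 + single b a 1 : SymM N p).IsSymm := by
    rw [Matrix.IsSymm, transpose_add, transpose_single, transpose_single, add_comm]
  rw [hS.2 _ hsymm]
  have hpair (c d : VIdx N p) :
      ∑ x, ∑ z, (single c d 1 : SymM N p) x z * S x z = S c d := by
    simp [single_apply, ite_and]
  simp only [Matrix.add_apply, add_mul, Finset.sum_add_distrib, hpair, hS.1.apply a b]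
  ring

theorem IsAdjointU.apply_diag {N p : ℕ} {y : Fin N → ℝ} {S : SymM N p}
    (hS : IsAdjointU N p y S) (i : Fin N) (l : Fin p) :
    S (i, i, l) (i, i, l) = y i / 2 := by
  have hU (m : Fin N) :
      mfU N p (single (i, i, l) (i, i, l) 1 + single (i, i, l) (i, i, l) 1) m
        = if i = m then 1 else 0 := by
    rw [mfU, Finset.sum_eq_single l, Finset.sum_eq_zero]
    · by_cases h : i = m <;> simp [h]; norm_num
    · intro j hj
      have hj : j ≠ m := by simpa using hj
      simp only [Matrix.add_apply, single_apply, Prod.mk.injEq]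
      grind
    · intro r _ hr
      simp [hr.symm]
    · simp
  have h := hS.two_mul_apply (i, i, l) (i, i, l)
  simp only [hU, ite_mul, one_mul, zero_mul, Finset.sum_ite_eq, Finset.mem_univ, if_true] at h
  linarith

theorem IsAdjointU.apply_offDiag {N p : ℕ} {y : Fin N → ℝ} {S : SymM N p}
    (hS : IsAdjointU N p y S) {i j : Fin N} (hij : i ≠ j) (l : Fin p) :
    S (i, i, l) (j, i, l) = y j / 2 := by
  have hU (m : Fin N) :
      mfU N p (single (i, i, l) (j, i, l) 1 + single (j, i, l) (i, i, l) 1) m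
        = if j = m then 1 else 0 := by
    rw [mfU, Finset.sum_eq_single l]
    · have hin (q : Fin N) (hq : q ≠ m) :
          (single (i, i, l) (j, i, l) 1 + single (j, i, l) (i, i, l) 1 : SymM N p)
              (q, q, l) (m, q, l)
            + (single (i, i, l) (j, i, l) 1 + single (j, i, l) (i, i, l) 1 : SymM N p)
              (m, q, l) (q, q, l) = if i = q then (if j = m then 2 else 0) else 0 := by
        simp only [Matrix.add_apply, single_apply, Prod.mk.injEq]
        grind
      rw [Finset.sum_congr rfl fun q hq => hin q (by simpa using hq), Finset.sum_ite_eq]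
      simp only [Matrix.add_apply, single_apply, Prod.mk.injEq, Finset.mem_filter,
        Finset.mem_univ, true_and]
      grind
    · intro r _ hr
      simp [hr.symm]
    · simp
  have h := hS.two_mul_apply (i, i, l) (j, i, l)
  simp only [hU, ite_mul, one_mul, zero_mul, Finset.sum_ite_eq, Finset.mem_univ, if_true] at h
  linarith

theorem IsAdjointU.apply_diag_of_ne {N p : ℕ} {y : Fin N → ℝ} {S : SymM N p}
    (hS : IsAdjointU N p y S) {i j : Fin N} (hij : i ≠ j) (l : Fin p) :
    S (j, i, l) (j, i, l) = 0 := by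
  have hU (m : Fin N) :
      mfU N p (single (j, i, l) (j, i, l) 1 + single (j, i, l) (j, i, l) 1) m = 0 := by
    rw [mfU, Finset.sum_eq_zero, mul_zero]
    intro r _
    rw [Finset.sum_eq_zero]
    · simp only [Matrix.add_apply, single_apply, Prod.mk.injEq]
      grind
    · intro q _
      simp only [Matrix.add_apply, single_apply, Prod.mk.injEq]
      grind
  have h := hS.two_mul_apply (j, i, l) (j, i, l)
  simp only [hU, zero_mul, Finset.sum_const_zero] at h
  linarith

/-- for `N ≥ 2`, if `k ≥ 0` and `k·Iₙ + 𝔘*(y)` is positive semidefinite, then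
`(y_j)² ≤ 4k² + 2k·y_i` for every pair of distinct indices `i ≠ j`. -/
theorem stmt5 (N p : ℕ) (hN : 2 ≤ N) (hp : 1 ≤ p) (k : ℝ) (hk : 0 ≤ k)
    (y : Fin N → ℝ) (S : SymM N p) (hS : IsAdjointU N p y S)
    (hpsd : (k • (1 : SymM N p) + S).PosSemidef) :
    ∀ i j : Fin N, i ≠ j → (y j) ^ 2 ≤ 4 * k ^ 2 + 2 * k * y i := by
  intro i j hij
  let l : Fin p := ⟨0, hp⟩
  have hne : ((i, i, l) : VIdx N p) ≠ (j, i, l) := by simp [hij]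
  have hdet := (hpsd.submatrix ![((i, i, l) : VIdx N p), (j, i, l)]).det_nonneg
  rw [det_fin_two] at hdet
  simp only [submatrix_apply, cons_val_zero, cons_val_one, Matrix.add_apply, Matrix.smul_apply,
    one_apply_eq, one_apply_ne hne, one_apply_ne hne.symm, smul_eq_mul,
    hS.apply_diag, hS.apply_offDiag hij, hS.apply_diag_of_ne hij,
    ← hS.1.apply (j, i, l) (i, i, l)] at hdet
  linarith
end
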